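/- arXiv:1512.07289 — 2 statements merged into one kernel-verified Lean document; each statement's English description precedes it below -/
import Mathlib

section
/- For every n ≥ 3 there exist origin-symmetric convex bodies K and L in R^n such that S_K(t) = S_L(t) for all t ≥ 0, but |K| ≠ |L|. That is, the distribution function of the areas of central hyperplane sections does not determine the volume of an origin-symmetric convex body in dimensions n ≥ 3. -/
open MeasureTheory Metric Set
open scoped RealInnerProductSpace ENNReal NNReal

noncomputable section

/-- Euclidean space `ℝ^n`. -/
abbrev Euc (n : ℕ) := EuclideanSpace ℝ (Fin n)

/-- A convex body: a compact convex set with nonempty interior. -/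
def IsConvexBody {n : ℕ} (K : Set (Euc n)) : Prop :=
  Convex ℝ K ∧ IsCompact K ∧ (interior K).Nonempty

/-- The Haar (rotation invariant) probability measure of a set of directions on the
unit sphere `S^{n-1}`, realized as normalized `(n-1)`-dimensional Hausdorff measure. -/
def sphHaar (n : ℕ) (A : Set (Euc n)) : ℝ≥0∞ :=
  μH[(n : ℝ) - 1] (A ∩ sphere (0 : Euc n) 1) / μH[(n : ℝ) - 1] (sphere (0 : Euc n) 1)

/-- `|K ∩ θ^⊥|`: the `(n-1)`-dimensional Hausdorff measure of the central section of `K`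
perpendicular to `θ`. -/
def sectionVol (n : ℕ) (K : Set (Euc n)) (θ : Euc n) : ℝ≥0∞ :=
  μH[(n : ℝ) - 1] (K ∩ {x : Euc n | ⟪x, θ⟫ = 0})

/-- `S_K(t)`: distribution function of the areas of central hyperplane sections. -/
def Sdist (n : ℕ) (K : Set (Euc n)) (t : ℝ) : ℝ≥0∞ :=
  sphHaar n {θ : Euc n | ENNReal.ofReal t ≤ sectionVol n K θ}

/-- `|K | θ^⊥|`: the `(n-1)`-dimensional Hausdorff measure of the orthogonal projection
of `K` onto the hyperplane `θ^⊥` (for a unit vector `θ`). -/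
def projVol (n : ℕ) (K : Set (Euc n)) (θ : Euc n) : ℝ≥0∞ :=
  μH[(n : ℝ) - 1] ((fun x => x - ⟪x, θ⟫ • θ) '' K)

/-- `Π_K(t)`: distribution function of the volumes of hyperplane projections. -/
def PiDist (n : ℕ) (K : Set (Euc n)) (t : ℝ) : ℝ≥0∞ :=
  sphHaar n {θ : Euc n | ENNReal.ofReal t ≤ projVol n K θ}

/-- The radial function `ρ_K(θ) = max {a ≥ 0 : a • θ ∈ K}`. -/
def radial {n : ℕ} (K : Set (Euc n)) (θ : Euc n) : ℝ :=
  sSup {a : ℝ | 0 ≤ a ∧ a • θ ∈ K}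

/-- The support function `h_K(θ) = sup_{y ∈ K} ⟨θ, y⟩`. -/
def suppFn {n : ℕ} (K : Set (Euc n)) (θ : Euc n) : ℝ :=
  sSup ((fun y => ⟪θ, y⟫) '' K)

/-- The polar body `K° = {x : ⟨x, y⟩ ≤ 1 for all y ∈ K}`. -/
def polarBody {n : ℕ} (K : Set (Euc n)) : Set (Euc n) :=
  {x | ∀ y ∈ K, ⟪x, y⟫ ≤ 1}

/-- The star-shaped set with radial function `h`. -/
def starSet {E : Type*} [NormedAddCommGroup E] [NormedSpace ℝ E] (h : E → ℝ) : Set E :=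
  {x | ‖x‖ ≤ h (‖x‖⁻¹ • x)}

theorem volumeIoiPow_Iic (n : ℕ) (x : Ioi (0 : ℝ)) :
    Measure.volumeIoiPow n (Iic x) = ENNReal.ofReal (x.1 ^ (n + 1) / (n + 1)) := by
  have h0 : Measure.volumeIoiPow n {x} = 0 := by
    refine withDensity_absolutelyContinuous _ _ ?_
    rw [comap_subtype_coe_apply measurableSet_Ioi]
    simp
  rw [← Measure.volumeIoiPow_apply_Iio, ← Iio_union_right]
  refine le_antisymm ((measure_union_le _ _).trans (by rw [h0, add_zero])) ?_
  exact measure_mono subset_union_left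

theorem measure_starSet {E : Type*} [NormedAddCommGroup E] [NormedSpace ℝ E]
    [MeasurableSpace E] [BorelSpace E] [FiniteDimensional ℝ E] [Nontrivial E]
    (μ : Measure E) [μ.IsAddHaarMeasure] {h : E → ℝ} (hh : Measurable h)
    (hpos : ∀ u, ‖u‖ = 1 → 0 < h u) :
    μ (starSet h) = ∫⁻ u : sphere (0 : E) 1,
      ENNReal.ofReal (h u ^ Module.finrank ℝ E / Module.finrank ℝ E) ∂μ.toSphere := by
  have hmeas : MeasurableSet (starSet h) := by
    apply measurableSet_le
    · fun_prop
    · fun_prop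
  have h1 : μ (starSet h) = μ.comap ((↑) : ({0}ᶜ : Set E) → E) ((↑) ⁻¹' starSet h) := by
    rw [comap_subtype_coe_apply (measurableSet_singleton _).compl, Subtype.image_preimage_coe]
    rw [← measure_sdiff_null (s := starSet h) (measure_singleton (0 : E)), sdiff_eq, inter_comm]
  set S : Set (sphere (0 : E) 1 × Ioi (0 : ℝ)) := {p | p.2.1 ≤ h p.1} with hS
  have hSm : MeasurableSet S := by
    apply measurableSet_le
    · fun_prop
    · fun_prop
  have h2 : ((↑) ⁻¹' starSet h : Set ({0}ᶜ : Set E)) = homeomorphUnitSphereProd E ⁻¹' S := by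
    ext x
    simp [starSet, hS]
  rw [h1, h2, μ.measurePreserving_homeomorphUnitSphereProd.measure_preimage hSm.nullMeasurableSet,
    Measure.prod_apply hSm]
  refine lintegral_congr fun u => ?_
  have hu : 0 < h u := hpos u (by simp)
  have : Prod.mk u ⁻¹' S = Iic (⟨h u, hu⟩ : Ioi (0 : ℝ)) := by
    ext r
    simp [hS, ← Subtype.coe_le_coe]
  have hd : 0 < Module.finrank ℝ E := Module.finrank_pos
  rw [this, volumeIoiPow_Iic, Nat.sub_add_cancel hd, Nat.cast_pred hd]
  simp

open scoped Pointwise in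
theorem toSphere_integral_comp {E : Type*} [NormedAddCommGroup E] [InnerProductSpace ℝ E]
    [MeasurableSpace E] [BorelSpace E] [FiniteDimensional ℝ E] (U : E ≃ₗᵢ[ℝ] E) (f : E → ℝ) :
    ∫ u : sphere (0 : E) 1, f (U u) ∂(volume : Measure E).toSphere
      = ∫ u : sphere (0 : E) 1, f u ∂(volume : Measure E).toSphere := by
  let e : sphere (0 : E) 1 ≃ᵐ sphere (0 : E) 1 :=
    { toFun := fun u => ⟨U u, by simp⟩
      invFun := fun u => ⟨U.symm u, by simp⟩
      left_inv := fun u => by simp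
      right_inv := fun u => by simp
      measurable_toFun := by
        apply Measurable.subtype_mk
        exact U.continuous.measurable.comp measurable_subtype_coe
      measurable_invFun := by
        apply Measurable.subtype_mk
        exact U.symm.continuous.measurable.comp measurable_subtype_coe }
  have hmp : MeasurePreserving e (volume : Measure E).toSphere (volume : Measure E).toSphere := by
    refine ⟨e.measurable, ?_⟩
    ext s hs
    rw [Measure.map_apply e.measurable hs, Measure.toSphere_apply' _ hs,
      Measure.toSphere_apply' _ (e.measurable hs)]
    congr 1
    rw [← U.measurePreserving.measure_preimage_emb
      U.toHomeomorph.toMeasurableEquiv.measurableEmbedding (Ioo (0 : ℝ) 1 • (Subtype.val '' s))]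
    congr 1
    ext x
    simp only [Set.mem_smul, mem_image, mem_preimage, Subtype.exists, exists_and_right,
      exists_eq_right]
    constructor
    · rintro ⟨r, hr, y, ⟨hy, hys⟩, rfl⟩
      exact ⟨r, hr, U y, ⟨(e ⟨y, hy⟩).2, hys⟩, by simp⟩
    · rintro ⟨r, hr, y, ⟨hy, hys⟩, hxy⟩
      refine ⟨r, hr, U.symm y, ⟨by simpa using hy, ?_⟩, ?_⟩
      · simpa [e] using hys
      · apply U.injective
        simpa using hxy
  exact hmp.integral_comp e.measurableEmbedding (fun u => f u)

/-- The linear functional on continuous functions given by integration over the unit sphere. -/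
def sphInt (N : ℕ) : C(sphere (0 : Euc N) 1, ℝ) →ₗ[ℝ] ℝ where
  toFun f := ∫ u, f u ∂(volume : Measure (Euc N)).toSphere
  map_add' f g := integral_add
    (f.continuous.integrable_of_hasCompactSupport (HasCompactSupport.of_compactSpace f))
    (g.continuous.integrable_of_hasCompactSupport (HasCompactSupport.of_compactSpace g))
  map_smul' c _ := integral_const_mul c _

/-- The restriction of the linear form `⟪w, ·⟫` to the unit sphere. -/
def sphForm {N : ℕ} (w : Euc N) : C(sphere (0 : Euc N) 1, ℝ) :=
  ⟨fun u => ⟪w, (u : Euc N)⟫, by fun_prop⟩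

/-- The `i`-th coordinate vector. -/
abbrev basisVec {N : ℕ} (i : Fin N) : Euc N := EuclideanSpace.single i 1

/-- The `2k`-th moment of a coordinate on the unit sphere. -/
def sphMoment (N k : ℕ) [NeZero N] : ℝ := sphInt N (sphForm (basisVec 0) ^ (2 * k))

theorem sphInt_form_pow_of_norm_eq {N : ℕ} {v w : Euc N} (h : ‖v‖ = ‖w‖) (m : ℕ) :
    sphInt N (sphForm v ^ m) = sphInt N (sphForm w ^ m) := by
  let U : Euc N ≃ₗᵢ[ℝ] Euc N := (ℝ ∙ (v - w))ᗮ.reflection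
  have hU : U v = w := Submodule.reflection_sub h
  have := toSphere_integral_comp U (fun u => ⟪w, u⟫ ^ m)
  rw [← hU] at this
  simp only [LinearIsometryEquiv.inner_map_map] at this
  rw [hU] at this
  exact this

theorem sphInt_form_pow {N : ℕ} [NeZero N] (v : Euc N) (k : ℕ) :
    sphInt N (sphForm v ^ (2 * k)) = (‖v‖ ^ 2) ^ k * sphMoment N k := by
  rw [sphInt_form_pow_of_norm_eq (w := ‖v‖ • basisVec 0) (by simp [norm_smul]), sphMoment]
  have : sphForm (‖v‖ • basisVec 0) ^ (2 * k) =
      ((‖v‖ ^ 2) ^ k) • sphForm (basisVec (0 : Fin N)) ^ (2 * k) := by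
    ext u
    simp [sphForm, real_inner_smul_left, mul_pow, pow_mul]
  rw [this, map_smul, smul_eq_mul]

theorem norm_sq_pair {N : ℕ} {i j : Fin N} (hij : i ≠ j) (a b : ℝ) :
    ‖a • basisVec i + b • (basisVec j : Euc N)‖ ^ 2 = a ^ 2 + b ^ 2 := by
  rw [norm_add_sq_real]
  have : ⟪(basisVec i : Euc N), basisVec j⟫ = 0 := by
    simp [basisVec, EuclideanSpace.inner_single_left, hij]
  simp [norm_smul, real_inner_smul_left, real_inner_smul_right, this]

theorem sphInt_pair_pow {N : ℕ} [NeZero N] {i j : Fin N} (hij : i ≠ j) (a b : ℝ) (k : ℕ) :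
    sphInt N ((a • sphForm (basisVec i) + b • sphForm (basisVec j)) ^ (2 * k)) =
      (a ^ 2 + b ^ 2) ^ k * sphMoment N k := by
  rw [← norm_sq_pair hij, ← sphInt_form_pow]
  congr 2
  ext u
  simp [sphForm, inner_add_left, real_inner_smul_left]

theorem sphInt_coord_pow {N : ℕ} [NeZero N] (i : Fin N) (k : ℕ) :
    sphInt N (sphForm (basisVec i) ^ (2 * k)) = sphMoment N k := by
  rw [sphInt_form_pow]; simp

theorem sum_sphForm_sq {N : ℕ} :
    ∑ i : Fin N, sphForm (basisVec i) ^ 2 = (1 : C(sphere (0 : Euc N) 1, ℝ)) := by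
  ext u
  have := EuclideanSpace.real_norm_sq_eq (u : Euc N)
  simp [sphForm, EuclideanSpace.inner_single_left] at this ⊢
  exact this.symm

section Moments

variable {N : ℕ} [NeZero N] {i j : Fin N}

theorem sphInt_two_two (hij : i ≠ j) :
    sphInt N (sphForm (basisVec i) ^ 2 * sphForm (basisVec j) ^ 2) = sphMoment N 2 / 3 := by
  have h1 := sphInt_pair_pow hij 1 1 2
  have h2 := sphInt_pair_pow hij 1 (-1) 2
  have hi := sphInt_coord_pow i 2
  have hj := sphInt_coord_pow j 2
  set x := sphForm (basisVec i)
  set y := sphForm (basisVec j)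
  have key : ((1 : ℝ) • x + (1 : ℝ) • y) ^ (2 * 2) + ((1 : ℝ) • x + (-1 : ℝ) • y) ^ (2 * 2) =
      (2 : ℝ) • x ^ (2 * 2) + (12 : ℝ) • (x ^ 2 * y ^ 2) + (2 : ℝ) • y ^ (2 * 2) := by
    ext u; simp; ring
  have := congrArg (sphInt N) key
  simp only [map_add, map_smul, smul_eq_mul] at this
  norm_num at *
  linarith

theorem sphInt_four_two (hij : i ≠ j) :
    sphInt N (sphForm (basisVec i) ^ 4 * sphForm (basisVec j) ^ 2) = sphMoment N 3 / 5 := by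
  have h1 := sphInt_pair_pow hij 1 1 3
  have h2 := sphInt_pair_pow hij 1 (-1) 3
  have h3 := sphInt_pair_pow hij 2 1 3
  have h4 := sphInt_pair_pow hij 2 (-1) 3
  have hi := sphInt_coord_pow i 3
  have hj := sphInt_coord_pow j 3
  set x := sphForm (basisVec i)
  set y := sphForm (basisVec j)
  have key : ((1 : ℝ) • x + (1 : ℝ) • y) ^ (2 * 3) + ((1 : ℝ) • x + (-1 : ℝ) • y) ^ (2 * 3) =
      (2 : ℝ) • x ^ (2 * 3) + (30 : ℝ) • (x ^ 4 * y ^ 2) + (30 : ℝ) • (x ^ 2 * y ^ 4)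
       + (2 : ℝ) • y ^ (2 * 3) := by
    ext u; simp; ring
  have key2 : ((2 : ℝ) • x + (1 : ℝ) • y) ^ (2 * 3) + ((2 : ℝ) • x + (-1 : ℝ) • y) ^ (2 * 3) =
      (128 : ℝ) • x ^ (2 * 3) + (480 : ℝ) • (x ^ 4 * y ^ 2) + (120 : ℝ) • (x ^ 2 * y ^ 4)
       + (2 : ℝ) • y ^ (2 * 3) := by
    ext u; simp; ring
  have e1 := congrArg (sphInt N) key
  have e2 := congrArg (sphInt N) key2
  simp only [map_add, map_smul, smul_eq_mul] at e1 e2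
  norm_num at *
  linarith

theorem sphInt_six_two_and_four_four (hij : i ≠ j) :
    sphInt N (sphForm (basisVec i) ^ 6 * sphForm (basisVec j) ^ 2) = sphMoment N 4 / 7 ∧
    sphInt N (sphForm (basisVec i) ^ 4 * sphForm (basisVec j) ^ 4) = 3 * sphMoment N 4 / 35 := by
  have h1 := sphInt_pair_pow hij 1 1 4
  have h2 := sphInt_pair_pow hij 1 (-1) 4
  have h3 := sphInt_pair_pow hij 2 1 4
  have h4 := sphInt_pair_pow hij 2 (-1) 4
  have h5 := sphInt_pair_pow hij 3 1 4
  have h6 := sphInt_pair_pow hij 3 (-1) 4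
  have hi := sphInt_coord_pow i 4
  have hj := sphInt_coord_pow j 4
  set x := sphForm (basisVec i)
  set y := sphForm (basisVec j)
  have key (a : ℝ) : (a • x + (1 : ℝ) • y) ^ (2 * 4) + (a • x + (-1 : ℝ) • y) ^ (2 * 4) =
      (2 * a ^ 8) • x ^ (2 * 4) + (56 * a ^ 6) • (x ^ 6 * y ^ 2)
       + (140 * a ^ 4) • (x ^ 4 * y ^ 4) + (56 * a ^ 2) • (x ^ 2 * y ^ 6)
       + (2 : ℝ) • y ^ (2 * 4) := by
    ext u; simp; ring
  have e1 := congrArg (sphInt N) (key 1)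
  have e2 := congrArg (sphInt N) (key 2)
  have e3 := congrArg (sphInt N) (key 3)
  simp only [map_add, map_smul, smul_eq_mul] at e1 e2 e3
  norm_num at *
  constructor <;> linarith

theorem sphMoment_one : N * sphMoment N 1 = sphInt N 1 := by
  rw [← sum_sphForm_sq, map_sum]
  rw [Finset.sum_congr rfl (fun i _ => sphInt_coord_pow i 1)]
  simp

theorem sphInt_mul_sum (f : C(sphere (0 : Euc N) 1, ℝ)) {c : ℝ}
    (hf : ∀ j, j ≠ i → sphInt N (f * sphForm (basisVec j) ^ 2) = c) :
    sphInt N (f * sphForm (basisVec i) ^ 2) + (N - 1) * c = sphInt N f := by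
  conv_rhs => rw [← mul_one f, ← sum_sphForm_sq, Finset.mul_sum, map_sum]
  rw [← Finset.add_sum_erase _ _ (Finset.mem_univ i),
    Finset.sum_congr rfl (fun j hj => hf j (Finset.ne_of_mem_erase hj))]
  simp [Nat.cast_pred (NeZero.pos N)]

theorem sphMoment_two : (N + 2) * sphMoment N 2 = 3 * sphMoment N 1 := by
  have h := sphInt_mul_sum (i := (0 : Fin N)) _ (fun j hj => sphInt_two_two hj.symm)
  have h0 := sphInt_coord_pow (0 : Fin N) 2
  have h1 := sphInt_coord_pow (0 : Fin N) 1
  rw [← pow_add] at h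
  norm_num at *
  rw [h0, h1] at h
  linarith

theorem sphMoment_three : (N + 4) * sphMoment N 3 = 5 * sphMoment N 2 := by
  have h := sphInt_mul_sum (i := (0 : Fin N)) _ (fun j hj => sphInt_four_two hj.symm)
  have h0 := sphInt_coord_pow (0 : Fin N) 3
  have h1 := sphInt_coord_pow (0 : Fin N) 2
  rw [← pow_add] at h
  norm_num at *
  rw [h0, h1] at h
  linarith

theorem sphInt_one_pos : 0 < sphInt N 1 := by
  have : Nonempty (Fin N) := ⟨0⟩
  change 0 < ∫ _, (1 : ℝ) ∂(volume : Measure (Euc N)).toSphere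
  rw [integral_const, smul_eq_mul, mul_one, measureReal_def]
  exact ENNReal.toReal_pos (Measure.measure_univ_ne_zero.2 (Measure.toSphere_ne_zero _))
    (measure_ne_top _ _)

end Moments

/-- A function which is bounded and has a uniform first order Taylor expansion with quadratic
remainder on the unit sphere. -/
def HasSphTaylor {n : ℕ} (f : Euc n → ℝ) : Prop :=
  ∃ C : ℝ, 0 ≤ C ∧ ∀ u, ‖u‖ = 1 → |f u| ≤ C ∧ ∃ w : Euc n, |⟪w, u⟫| ≤ C ∧
    ∀ v, ‖v‖ = 1 → |f v - f u - ⟪w, v - u⟫| ≤ C * ‖v - u‖ ^ 2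

namespace HasSphTaylor

variable {n : ℕ} {f g : Euc n → ℝ}

theorem add (hf : HasSphTaylor f) (hg : HasSphTaylor g) : HasSphTaylor (fun x => f x + g x) := by
  obtain ⟨C, hC, h⟩ := hf
  obtain ⟨D, hD, k⟩ := hg
  refine ⟨C + D, by positivity, fun u hu => ?_⟩
  obtain ⟨h1, w, hw, h2⟩ := h u hu
  obtain ⟨k1, z, hz, k2⟩ := k u hu
  refine ⟨(abs_add_le _ _).trans (by gcongr), w + z, ?_, fun v hv => ?_⟩
  · rw [inner_add_left]
    exact (abs_add_le _ _).trans (by gcongr)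
  · rw [inner_add_left]
    have := (abs_add_le _ _).trans (add_le_add (h2 v hv) (k2 v hv))
    refine le_trans (le_of_eq ?_) (this.trans_eq (by ring))
    congr 1
    ring

theorem const_mul (hf : HasSphTaylor f) (c : ℝ) : HasSphTaylor (fun x => c * f x) := by
  obtain ⟨C, hC, h⟩ := hf
  refine ⟨|c| * C, by positivity, fun u hu => ?_⟩
  obtain ⟨h1, w, hw, h2⟩ := h u hu
  refine ⟨by rw [abs_mul]; gcongr, c • w, ?_, fun v hv => ?_⟩
  · rw [real_inner_smul_left, abs_mul]; gcongr
  · rw [real_inner_smul_left, ← mul_sub, ← mul_sub, abs_mul, mul_assoc]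
    gcongr
    exact h2 v hv

theorem inner_sq (a : Euc n) : HasSphTaylor (fun x => ⟪a, x⟫ ^ 2) := by
  refine ⟨2 * ‖a‖ ^ 2, by positivity, fun u hu => ?_⟩
  have hau : |⟪a, u⟫| ≤ ‖a‖ := by simpa [hu] using abs_real_inner_le_norm a u
  have hsq : ⟪a, u⟫ ^ 2 ≤ ‖a‖ ^ 2 := sq_le_sq.2 (by simpa using hau)
  refine ⟨?_, (2 * ⟪a, u⟫) • a, ?_, fun v hv => ?_⟩
  · rw [abs_of_nonneg (by positivity)]; nlinarith
  · rw [real_inner_smul_left, mul_assoc, ← sq, abs_of_nonneg (by positivity)]; nlinarith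
  · have hd : ⟪a, v - u⟫ ^ 2 ≤ (‖a‖ * ‖v - u‖) ^ 2 :=
      sq_le_sq.2 (by simpa [abs_mul] using abs_real_inner_le_norm a (v - u))
    rw [real_inner_smul_left]
    have : ⟪a, v⟫ ^ 2 - ⟪a, u⟫ ^ 2 - 2 * ⟪a, u⟫ * ⟪a, v - u⟫ = ⟪a, v - u⟫ ^ 2 := by
      rw [inner_sub_right]; ring
    rw [this, abs_of_nonneg (by positivity)]
    nlinarith

theorem inner_pow_four (a : Euc n) : HasSphTaylor (fun x => ⟪a, x⟫ ^ 4) := by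
  refine ⟨6 * ‖a‖ ^ 4, by positivity, fun u hu => ?_⟩
  have hau : |⟪a, u⟫| ≤ ‖a‖ := by simpa [hu] using abs_real_inner_le_norm a u
  have hsq : ⟪a, u⟫ ^ 2 ≤ ‖a‖ ^ 2 := sq_le_sq.2 (by simpa using hau)
  have h4 : ⟪a, u⟫ ^ 4 ≤ ‖a‖ ^ 4 := by
    have := pow_le_pow_left₀ (by positivity) hsq 2
    calc _ = (⟪a, u⟫ ^ 2) ^ 2 := by ring
      _ ≤ _ := this
      _ = _ := by ring
  have hp : 0 ≤ ⟪a, u⟫ ^ 4 := by positivity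
  refine ⟨?_, (4 * ⟪a, u⟫ ^ 3) • a, ?_, fun v hv => ?_⟩
  · rw [abs_of_nonneg (by positivity)]; linarith
  · have : 4 * ⟪a, u⟫ ^ 3 * ⟪a, u⟫ = 4 * ⟪a, u⟫ ^ 4 := by ring
    rw [real_inner_smul_left, this, abs_of_nonneg (by positivity)]; linarith
  · have hd : ⟪a, v - u⟫ ^ 2 ≤ (‖a‖ * ‖v - u‖) ^ 2 :=
      sq_le_sq.2 (by simpa [abs_mul] using abs_real_inner_le_norm a (v - u))
    have hav : |⟪a, v⟫| ≤ ‖a‖ := by simpa [hv] using abs_real_inner_le_norm a v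
    have hsqv : ⟪a, v⟫ ^ 2 ≤ ‖a‖ ^ 2 := sq_le_sq.2 (by simpa using hav)
    rw [real_inner_smul_left]
    have : ⟪a, v⟫ ^ 4 - ⟪a, u⟫ ^ 4 - 4 * ⟪a, u⟫ ^ 3 * ⟪a, v - u⟫ =
        ((⟪a, v⟫ + ⟪a, u⟫) ^ 2 + 2 * ⟪a, u⟫ ^ 2) * ⟪a, v - u⟫ ^ 2 := by
      rw [inner_sub_right]; ring
    rw [this, abs_of_nonneg (by positivity)]
    have h6 : (⟪a, v⟫ + ⟪a, u⟫) ^ 2 + 2 * ⟪a, u⟫ ^ 2 ≤ 6 * ‖a‖ ^ 2 := by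
      nlinarith [sq_nonneg (⟪a, v⟫ - ⟪a, u⟫)]
    calc _ ≤ (6 * ‖a‖ ^ 2) * (‖a‖ * ‖v - u‖) ^ 2 := by gcongr
      _ = _ := by ring

end HasSphTaylor

theorem starSet_eq_iInter_halfspaces {n : ℕ} {h : Euc n → ℝ} (h0 : 0 ≤ h 0)
    (hpos : ∀ u, ‖u‖ = 1 → 0 < h u) (p : Euc n → Euc n)
    (hp : ∀ u, ‖u‖ = 1 → ⟪p u, u⟫ * h u = 1)
    (hp' : ∀ u v, ‖u‖ = 1 → ‖v‖ = 1 → ⟪p u, v⟫ * h v ≤ 1) :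
    starSet h = ⋂ u : sphere (0 : Euc n) 1, {x | ⟪p u, x⟫ ≤ 1} := by
  ext x
  simp only [starSet, mem_ofPred_eq, mem_iInter]
  rcases eq_or_ne x 0 with rfl | hx
  · simpa using h0
  have hv : ‖‖x‖⁻¹ • x‖ = 1 := by simp [norm_smul, hx]
  have hxv : x = ‖x‖ • (‖x‖⁻¹ • x) := by simp [hx]
  set v := ‖x‖⁻¹ • x
  have hxp : 0 < ‖x‖ := by simpa using hx
  constructor
  · intro hle u
    have hu : ‖(u : Euc n)‖ = 1 := by simp
    rw [hxv, real_inner_smul_right]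
    have := hp' u v hu hv
    rcases le_or_gt ⟪p u, v⟫ 0 with hneg | hpo
    · nlinarith
    · nlinarith
  · intro hall
    have := hall ⟨v, by simpa using hv⟩
    rw [hxv, real_inner_smul_right] at this
    have h1 := hp v hv
    have h2 := hpos v hv
    calc ‖x‖ = ‖x‖ * (⟪p v, v⟫ * h v) := by rw [h1, mul_one]
      _ = (‖x‖ * ⟪p v, v⟫) * h v := by ring
      _ ≤ 1 * h v := by gcongr
      _ = h v := one_mul _

/-- The radial function with `d`-th power `1 + ε f`. -/
def pertRadial {n : ℕ} (d : ℕ) (f : Euc n → ℝ) (ε : ℝ) (x : Euc n) : ℝ :=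
  (1 + ε * f x) ^ ((d : ℝ)⁻¹)

theorem HasSphTaylor.exists_isConvexBody {n d : ℕ} (hd : d ≠ 0) {f : Euc n → ℝ}
    (hf : HasSphTaylor f) (hf0 : f 0 = 0) :
    ∃ ε₀ > 0, ∀ ε, 0 < ε → ε ≤ ε₀ →
      (∀ u, ‖u‖ = 1 → |ε * f u| ≤ 1 / 2) ∧ IsConvexBody (starSet (pertRadial d f ε)) := by
  obtain ⟨C, hC, H⟩ := hf
  refine ⟨1 / (6 * (C + 1)), by positivity, fun ε hε hε' => ?_⟩
  have hεC : 6 * (ε * (C + 1)) ≤ 1 := by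
    rw [le_div_iff₀ (by positivity)] at hε'; linarith
  have hb : ∀ u, ‖u‖ = 1 → |ε * f u| ≤ 1 / 2 := fun u hu => by
    rw [abs_mul, abs_of_pos hε]
    have := mul_le_mul_of_nonneg_left (H u hu).1 hε.le
    nlinarith
  have hlow : ∀ u, ‖u‖ = 1 → 1 / 2 ≤ 1 + ε * f u := fun u hu => by
    linarith [(abs_le.1 (hb u hu)).1]
  have hup : ∀ u, ‖u‖ = 1 → 1 + ε * f u ≤ 2 := fun u hu => by
    linarith [(abs_le.1 (hb u hu)).2]
  have hd1 : (1 : ℝ) ≤ d := by exact_mod_cast Nat.one_le_iff_ne_zero.2 hd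
  set a : ℝ := (d : ℝ)⁻¹ with ha
  have ha0 : 0 < a := by positivity
  have ha1 : a ≤ 1 := inv_le_one_of_one_le₀ hd1
  have hpos : ∀ u, ‖u‖ = 1 → 0 < pertRadial d f ε u := fun u hu =>
    Real.rpow_pos_of_pos (by linarith [hlow u hu]) _
  choose! w hw hw' using fun u hu => (H u hu).2
  let β : Euc n → ℝ := fun u => a * ε / (1 + ε * f u)
  let p : Euc n → Euc n := fun u =>
    (pertRadial d f ε u)⁻¹ • (u - β u • (w u - ⟪w u, u⟫ • u))
  have heq : starSet (pertRadial d f ε) = ⋂ u : sphere (0 : Euc n) 1, {x | ⟪p u, x⟫ ≤ 1} := by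
    refine starSet_eq_iInter_halfspaces ?_ hpos p ?_ ?_
    · simp [pertRadial, hf0]
    · intro u hu
      have := (hpos u hu).ne'
      simp only [p, real_inner_smul_left, inner_sub_left, real_inner_self_eq_norm_sq, hu]
      field_simp
      ring
    · intro u v hu hv
      have hgu := hlow u hu
      have hgv := hlow v hv
      have hβ : 0 ≤ β u := by positivity
      have hβC : 3 * β u * C ≤ 1 := by
        have : β u ≤ 2 * ε := by
          rw [div_le_iff₀ (by linarith)]
          nlinarith
        nlinarith
      have hδ : ‖v - u‖ ^ 2 = 2 * (1 - ⟪u, v⟫) := by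
        rw [norm_sub_sq_real, hu, hv, real_inner_comm]; ring
      have hδ0 : 0 ≤ 1 - ⟪u, v⟫ := by nlinarith [sq_nonneg ‖v - u‖]
      set Q := ⟪u, v⟫ - β u * (⟪w u, v⟫ - ⟪w u, u⟫ * ⟪u, v⟫) with hQ
      set s := (ε * f v - ε * f u) / (1 + ε * f u) with hs
      have has : a * s = β u * (f v - f u) := by simp only [hs, β]; ring
      have hQs : Q ≤ 1 - a * s := by
        have h1 := (abs_le.1 (hw' u hu v hv)).2
        have h2 := (abs_le.1 (hw u hu)).1
        rw [hδ] at h1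
        rw [inner_sub_right] at h1
        have e : 1 - a * s - Q = (1 - ⟪u, v⟫)
            - β u * (f v - f u - (⟪w u, v⟫ - ⟪w u, u⟫)) + β u * (⟪w u, u⟫ * (1 - ⟪u, v⟫)) := by
          rw [has, hQ]; ring
        have h3 := mul_le_mul_of_nonneg_left h1 hβ
        have h4 := mul_le_mul_of_nonneg_left (mul_le_mul_of_nonneg_right h2 hδ0) hβ
        have h5 := mul_le_mul_of_nonneg_right hβC hδ0
        nlinarith
      have h1s : 1 + s = (1 + ε * f v) / (1 + ε * f u) := by
        rw [hs]; field_simp; ring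
      have hratio : pertRadial d f ε v / pertRadial d f ε u ≤ 1 + a * s := by
        rw [pertRadial, pertRadial, ← Real.div_rpow (by linarith) (by linarith), ← h1s]
        exact rpow_one_add_le_one_add_mul_self
          (by have : 0 ≤ 1 + s := by rw [h1s]; positivity
              linarith) ha0.le ha1
      have hratio0 : 0 < pertRadial d f ε v / pertRadial d f ε u := div_pos (hpos v hv) (hpos u hu)
      have : ⟪p u, v⟫ * pertRadial d f ε v = Q * (pertRadial d f ε v / pertRadial d f ε u) := by
        simp only [p, real_inner_smul_left, inner_sub_left, hQ]
        field_simp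
      rw [this]
      rcases le_or_gt Q 0 with hq | hq
      · nlinarith
      · nlinarith [sq_nonneg (a * s)]
  have hmem : ∀ x : Euc n, x ∈ starSet (pertRadial d f ε) → ‖x‖ ≤ 2 := by
    intro x hx
    rcases eq_or_ne x 0 with rfl | hx0
    · simp
    have hv : ‖‖x‖⁻¹ • x‖ = 1 := by simp [norm_smul, hx0]
    refine le_trans hx ((Real.rpow_le_rpow (by linarith [hlow _ hv]) (hup _ hv) ha0.le).trans ?_)
    simpa using Real.rpow_le_rpow_of_exponent_le (one_le_two) ha1
  refine ⟨hb, ?_, ?_, ?_⟩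
  · rw [heq]
    exact convex_iInter fun u =>
      convex_halfSpace_le (innerSL ℝ (p u)).isBoundedLinearMap.toIsLinearMap 1
  · refine Metric.isCompact_of_isClosed_isBounded ?_ ?_
    · rw [heq]
      exact isClosed_iInter fun u => isClosed_le (by fun_prop) (by fun_prop)
    · exact isBounded_iff_forall_norm_le.2 ⟨2, hmem⟩
  · refine ⟨0, mem_interior.2 ⟨ball 0 (1 / 2), ?_, isOpen_ball, by simp⟩⟩
    intro x hx
    rcases eq_or_ne x 0 with rfl | hx0
    · simp [starSet, pertRadial, hf0]
    have hv : ‖‖x‖⁻¹ • x‖ = 1 := by simp [norm_smul, hx0]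
    have hx' : ‖x‖ < 1 / 2 := by simpa using hx
    have h1 : (1 / 2 : ℝ) ≤ (1 / 2) ^ a := by
      simpa using Real.rpow_le_rpow_of_exponent_ge (x := 1 / 2) (by norm_num) (by norm_num) ha1
    exact hx'.le.trans (h1.trans (Real.rpow_le_rpow (by norm_num) (hlow _ hv) ha0.le))

theorem exists_isometry_range_eq_orthogonal {d : ℕ} {θ : Euc (d + 1)} (hθ : ‖θ‖ = 1) :
    ∃ ι : Euc d →ₗᵢ[ℝ] Euc (d + 1), range ι = {x | ⟪x, θ⟫ = 0} := by
  have hfr : Module.finrank ℝ (ℝ ∙ θ)ᗮ = d := by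
    have : Fact (Module.finrank ℝ (Euc (d + 1)) = d + 1) := ⟨by simp⟩
    exact Submodule.finrank_orthogonal_span_singleton (by rintro rfl; simp at hθ)
  let e := (stdOrthonormalBasis ℝ (ℝ ∙ θ)ᗮ).reindex (finCongr hfr)
  refine ⟨(ℝ ∙ θ)ᗮ.subtypeₗᵢ.comp e.repr.symm.toLinearIsometry, ?_⟩
  ext x
  simp only [LinearIsometry.coe_comp, range_comp, LinearIsometryEquiv.coe_toLinearIsometry,
    e.repr.symm.surjective.range_eq, image_univ, Submodule.coe_subtypeₗᵢ, mem_ofPred_eq]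
  simp [Submodule.mem_orthogonal_singleton_iff_inner_left]

theorem exists_inner_isometry_eq {d : ℕ} {θ : Euc (d + 1)} (hθ : ‖θ‖ = 1)
    {ι : Euc d →ₗᵢ[ℝ] Euc (d + 1)} (hι : range ι = {x | ⟪x, θ⟫ = 0}) (η : Euc (d + 1)) :
    ∃ y : Euc d, (∀ u, ⟪η, ι u⟫ = ⟪y, u⟫) ∧ ‖y‖ ^ 2 = ‖η‖ ^ 2 - ⟪η, θ⟫ ^ 2 := by
  have hmem : η - ⟪η, θ⟫ • θ ∈ range ι := by
    rw [hι]
    simp [inner_sub_left, real_inner_smul_left, hθ]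
  obtain ⟨y, hy⟩ := hmem
  refine ⟨y, fun u => ?_, ?_⟩
  · have h0 : ⟪ι u, θ⟫ = 0 := by
      have : ι u ∈ range ι := mem_range_self u
      rwa [hι] at this
    rw [← ι.inner_map_map, hy, inner_sub_left, real_inner_smul_left,
      real_inner_comm, real_inner_comm _ θ,
      h0, mul_zero, sub_zero, real_inner_comm]
  · rw [← ι.norm_map, hy, norm_sub_sq_real, norm_smul, hθ, real_inner_smul_right]
    rw [mul_one, Real.norm_eq_abs, sq_abs]; ring

/-- The ratio between the Hausdorff measure and the Lebesgue measure on `ℝ^d`. -/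
def hausdorffRatio (d : ℕ) : ℝ≥0 :=
  Measure.addHaarScalarFactor (μH[(d : ℝ)] : Measure (Euc d)) volume

theorem sectionVol_starSet {d : ℕ} {θ : Euc (d + 1)}
    {ι : Euc d →ₗᵢ[ℝ] Euc (d + 1)} (hι : range ι = {x | ⟪x, θ⟫ = 0}) (h : Euc (d + 1) → ℝ) :
    sectionVol (d + 1) (starSet h) θ = hausdorffRatio d * volume (starSet fun u => h (ι u)) := by
  have h1 : starSet h ∩ {x | ⟪x, θ⟫ = 0} = ι '' starSet fun u => h (ι u) := by
    rw [← hι, ← image_preimage_eq_inter_range]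
    congr 1
    ext x
    simp [starSet]
  have hd : (((d + 1 : ℕ) : ℝ) - 1) = d := by simp
  rw [sectionVol, h1, hd, ι.isometry.hausdorffMeasure_image (Or.inl d.cast_nonneg)]
  conv_lhs => rw [Measure.isAddLeftInvariant_eq_smul (μH[(d : ℝ)] : Measure (Euc d)) volume]
  rfl

theorem volume_starSet_pertRadial {N d : ℕ} [NeZero N] {f : Euc N → ℝ} (hf : Measurable f) {ε : ℝ}
    (hpos : ∀ u, ‖u‖ = 1 → 0 < 1 + ε * f u) (g : C(sphere (0 : Euc N) 1, ℝ))
    (hg : ∀ u : sphere (0 : Euc N) 1, g u = (1 + ε * f u) ^ ((N : ℝ) / d)) :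
    volume (starSet (pertRadial d f ε)) = ENNReal.ofReal (sphInt N g / N) := by
  have : Nonempty (Fin N) := ⟨0⟩
  rw [measure_starSet (h := pertRadial d f ε) volume
    (by change Measurable fun x => (1 + ε * f x) ^ ((d : ℝ)⁻¹); fun_prop)
    (fun u hu => Real.rpow_pos_of_pos (hpos u hu) _)]
  have hint (u : sphere (0 : Euc N) 1) : pertRadial d f ε u ^ Module.finrank ℝ (Euc N) /
      Module.finrank ℝ (Euc N) = ((N : ℝ)⁻¹ • g) u := by
    rw [pertRadial, ← Real.rpow_natCast, ← Real.rpow_mul (hpos u (by simp)).le,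
      finrank_euclideanSpace_fin]
    simp only [ContinuousMap.coe_smul, Pi.smul_apply, smul_eq_mul, hg]
    rw [inv_mul_eq_div (d : ℝ), inv_mul_eq_div]
  simp only [hint]
  rw [← ofReal_integral_eq_lintegral_ofReal]
  · congr 1
    change sphInt N _ = _
    rw [map_smul, smul_eq_mul, inv_mul_eq_div]
  · exact ((N : ℝ)⁻¹ • g).continuous.integrable_of_hasCompactSupport
      (HasCompactSupport.of_compactSpace _)
  · refine .of_forall fun u => ?_
    have := hpos u (by simp)
    simp only [ContinuousMap.coe_smul, Pi.smul_apply, smul_eq_mul, hg, Pi.zero_apply]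
    positivity

/-- A perturbation which is odd under exchanging two coordinates. -/
def pertOdd {N : ℕ} (i j : Fin N) (κ : ℝ) (x : Euc N) : ℝ :=
  (x i ^ 4 - x j ^ 4) - κ * (x i ^ 2 - x j ^ 2)

/-- The quartic harmonic perturbation `Re (x i + √-1 * x j) ^ 4`. -/
def pertHarmonic {N : ℕ} (i j : Fin N) (x : Euc N) : ℝ :=
  x i ^ 4 - 6 * x i ^ 2 * x j ^ 2 + x j ^ 4

theorem inner_basisVec {N : ℕ} (i : Fin N) (x : Euc N) : ⟪basisVec i, x⟫ = x i := by
  simp [EuclideanSpace.inner_single_left]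

theorem hasSphTaylor_pertOdd {N : ℕ} (i j : Fin N) (κ : ℝ) : HasSphTaylor (pertOdd i j κ) := by
  have h := (((HasSphTaylor.inner_pow_four (basisVec i)).add
    ((HasSphTaylor.inner_pow_four (basisVec j)).const_mul (-1))).add
    ((HasSphTaylor.inner_sq (basisVec i)).const_mul (-κ))).add
    ((HasSphTaylor.inner_sq (basisVec j)).const_mul κ)
  convert h using 2 with x
  simp only [inner_basisVec, pertOdd]
  ring

theorem pertHarmonic_eq {N : ℕ} (i j : Fin N) (x : Euc N) :
    pertHarmonic i j x = 2 * ⟪basisVec i, x⟫ ^ 4 + 2 * ⟪basisVec j, x⟫ ^ 4 +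
      (-1 / 2) * ⟪(basisVec i + basisVec j : Euc N), x⟫ ^ 4 +
      (-1 / 2) * ⟪(basisVec i - basisVec j : Euc N), x⟫ ^ 4 := by
  simp only [inner_add_left, inner_sub_left, inner_basisVec, pertHarmonic]
  ring

theorem hasSphTaylor_pertHarmonic {N : ℕ} (i j : Fin N) : HasSphTaylor (pertHarmonic i j) := by
  have h := ((((HasSphTaylor.inner_pow_four (basisVec i)).const_mul 2).add
    ((HasSphTaylor.inner_pow_four (basisVec j)).const_mul 2)).add
    ((HasSphTaylor.inner_pow_four (basisVec i + basisVec j)).const_mul (-1 / 2))).add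
    ((HasSphTaylor.inner_pow_four (basisVec i - basisVec j)).const_mul (-1 / 2))
  convert h using 2 with x
  exact pertHarmonic_eq i j x

theorem measurable_pertOdd {N : ℕ} (i j : Fin N) (κ : ℝ) : Measurable (pertOdd i j κ) := by
  unfold pertOdd; fun_prop

theorem measurable_pertHarmonic {N : ℕ} (i j : Fin N) : Measurable (pertHarmonic i j) := by
  unfold pertHarmonic; fun_prop

theorem sectionVol_pertRadial {d : ℕ} [NeZero d] {θ : Euc (d + 1)}
    {ι : Euc d →ₗᵢ[ℝ] Euc (d + 1)} (hι : range ι = {x | ⟪x, θ⟫ = 0}) {f : Euc (d + 1) → ℝ}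
    (hf : Measurable f) {ε : ℝ} (hpos : ∀ u, ‖u‖ = 1 → 0 < 1 + ε * f u)
    (g : C(sphere (0 : Euc d) 1, ℝ)) (hg : ∀ u : sphere (0 : Euc d) 1, g u = f (ι u)) :
    sectionVol (d + 1) (starSet (pertRadial d f ε)) θ =
      hausdorffRatio d * ENNReal.ofReal ((sphInt d 1 + ε * sphInt d g) / d) := by
  rw [sectionVol_starSet hι]
  congr 1
  have h := volume_starSet_pertRadial (d := d) (f := fun u => f (ι u))
    (hf.comp ι.continuous.measurable) (ε := ε) (fun u hu => hpos _ (by simpa using hu))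
    (1 + ε • g) (fun u => by simp [hg, NeZero.ne d])
  rw [map_add, map_smul, smul_eq_mul] at h
  exact h

theorem sectionVol_pertOdd {d : ℕ} [NeZero d] {θ : Euc (d + 1)} (hθ : ‖θ‖ = 1)
    (i j : Fin (d + 1)) {ε : ℝ}
    (hpos : ∀ u : Euc (d + 1), ‖u‖ = 1 → 0 < 1 + ε * pertOdd i j (6 / (d + 2)) u) :
    sectionVol (d + 1) (starSet (pertRadial d (pertOdd i j (6 / (d + 2))) ε)) θ =
      hausdorffRatio d * ENNReal.ofReal
        ((sphInt d 1 + ε * (sphMoment d 2 * (θ i ^ 4 - θ j ^ 4))) / d) := by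
  obtain ⟨ι, hι⟩ := exists_isometry_range_eq_orthogonal hθ
  obtain ⟨y, hy, hy'⟩ := exists_inner_isometry_eq hθ hι (basisVec i)
  obtain ⟨z, hz, hz'⟩ := exists_inner_isometry_eq hθ hι (basisVec j)
  rw [sectionVol_pertRadial hι (measurable_pertOdd ..) hpos
    (sphForm y ^ (2 * 2) - sphForm z ^ (2 * 2) -
      (6 / (d + 2) : ℝ) • (sphForm y ^ (2 * 1) - sphForm z ^ (2 * 1)))]
  · congr 4
    rw [map_sub, map_smul, map_sub, map_sub]
    simp only [sphInt_form_pow, hy', hz', inner_basisVec, smul_eq_mul]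
    simp only [PiLp.norm_single, norm_one]
    have := sphMoment_two (N := d)
    have h1 : 6 / (d + 2) * sphMoment d 1 = 2 * sphMoment d 2 := by
      field_simp; linarith
    linear_combination ε * (θ i ^ 2 - θ j ^ 2) * h1
  · intro u
    simp [sphForm, pertOdd, ← hy, ← hz, inner_basisVec]

theorem sectionVol_pertHarmonic {d : ℕ} [NeZero d] {θ : Euc (d + 1)} (hθ : ‖θ‖ = 1)
    {i j : Fin (d + 1)} (hij : i ≠ j) {ε : ℝ}
    (hpos : ∀ u : Euc (d + 1), ‖u‖ = 1 → 0 < 1 + ε * pertHarmonic i j u) :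
    sectionVol (d + 1) (starSet (pertRadial d (pertHarmonic i j) ε)) θ =
      hausdorffRatio d * ENNReal.ofReal
        ((sphInt d 1 + ε * (sphMoment d 2 * pertHarmonic i j θ)) / d) := by
  obtain ⟨ι, hι⟩ := exists_isometry_range_eq_orthogonal hθ
  obtain ⟨y, hy, hy'⟩ := exists_inner_isometry_eq hθ hι (basisVec i)
  obtain ⟨z, hz, hz'⟩ := exists_inner_isometry_eq hθ hι (basisVec j)
  obtain ⟨p, hp, hp'⟩ := exists_inner_isometry_eq hθ hι (basisVec i + basisVec j)
  obtain ⟨q, hq, hq'⟩ := exists_inner_isometry_eq hθ hι (basisVec i - basisVec j)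
  rw [sectionVol_pertRadial hι (measurable_pertHarmonic ..) hpos
    ((2 : ℝ) • sphForm y ^ (2 * 2) + (2 : ℝ) • sphForm z ^ (2 * 2) +
      (-1 / 2 : ℝ) • sphForm p ^ (2 * 2) + (-1 / 2 : ℝ) • sphForm q ^ (2 * 2))]
  · have e1 := norm_sq_pair hij 1 1
    have e2 := norm_sq_pair hij 1 (-1)
    simp only [one_smul, neg_smul, ← sub_eq_add_neg] at e1 e2
    congr 4
    rw [map_add, map_add, map_add, map_smul, map_smul, map_smul, map_smul]
    simp only [sphInt_form_pow, hy', hz', hp', hq', e1, e2, inner_add_left, inner_sub_left,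
      inner_basisVec, smul_eq_mul, pertHarmonic]
    simp only [PiLp.norm_single, norm_one]
    ring
  · intro u
    rw [pertHarmonic_eq]
    simp [sphForm, ← hy, ← hz, ← hp, ← hq]

theorem intervalIntegral_comp_mul_cos {G : ℝ → ℝ} (hG : Measurable G) (hb : ∀ x, ‖G x‖ ≤ 1)
    {k : ℕ} (hk : k ≠ 0) (ρ a : ℝ) :
    ∫ t in (0 : ℝ)..2 * Real.pi, G (ρ * Real.cos (k * t + a)) =
      ∫ t in (0 : ℝ)..2 * Real.pi, G (ρ * Real.cos t) := by
  have hper : Function.Periodic (fun t => G (ρ * Real.cos t)) (2 * Real.pi) := fun t => by simp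
  have hint : ∀ t₁ t₂, IntervalIntegrable (fun t => G (ρ * Real.cos t)) volume t₁ t₂ := fun _ _ =>
    (intervalIntegrable_const (c := (1 : ℝ))).mono_fun
      (Measurable.aestronglyMeasurable (by fun_prop))
      (.of_forall fun t => by simpa using hb _)
  have hk' : (k : ℝ) ≠ 0 := by exact_mod_cast hk
  have h := hper.intervalIntegral_add_zsmul_eq k a hint
  rw [hper.intervalIntegral_add_eq a 0, zero_add] at h
  rw [intervalIntegral.integral_comp_mul_add (fun t => G (ρ * Real.cos t)) hk']
  have e : (k : ℝ) * (2 * Real.pi) + a = a + (k : ℤ) • (2 * Real.pi) := by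
    simp; ring
  rw [e, mul_zero, zero_add, h]
  simp [hk']

/-- The rotation by the angle `t` in the plane of the coordinates `i` and `j`. -/
def planeRot {N : ℕ} (i j : Fin N) (t : ℝ) (x : Euc N) : Euc N :=
  x + (((Real.cos t - 1) * x i - Real.sin t * x j) • basisVec i +
    (Real.sin t * x i + (Real.cos t - 1) * x j) • basisVec j)

section PlaneRot

variable {N : ℕ} {i j : Fin N}

theorem planeRot_apply_fst (hij : i ≠ j) (t : ℝ) (x : Euc N) :
    planeRot i j t x i = Real.cos t * x i - Real.sin t * x j := by
  simp [planeRot, hij]; ring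

theorem planeRot_apply_snd (hij : i ≠ j) (t : ℝ) (x : Euc N) :
    planeRot i j t x j = Real.sin t * x i + Real.cos t * x j := by
  simp [planeRot, hij.symm]; ring

theorem norm_planeRot (hij : i ≠ j) (t : ℝ) (x : Euc N) : ‖planeRot i j t x‖ = ‖x‖ := by
  rw [← sq_eq_sq₀ (norm_nonneg _) (norm_nonneg _), planeRot, norm_add_sq_real, norm_sq_pair hij,
    inner_add_right, real_inner_smul_right, real_inner_smul_right, real_inner_comm _ x,
    real_inner_comm _ x, inner_basisVec, inner_basisVec]
  linear_combination (x i ^ 2 + x j ^ 2) * Real.sin_sq_add_cos_sq t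

theorem isometry_planeRot (hij : i ≠ j) (t : ℝ) : Isometry (planeRot i j t) := by
  refine Isometry.of_dist_eq fun x y => ?_
  rw [dist_eq_norm, dist_eq_norm, ← norm_planeRot hij t (x - y)]
  congr 1
  ext k
  simp only [planeRot, PiLp.add_apply, PiLp.sub_apply, PiLp.smul_apply, smul_eq_mul]
  ring

theorem surjective_planeRot (hij : i ≠ j) (t : ℝ) :
    Function.Surjective (planeRot i j t) := fun x => by
  refine ⟨planeRot i j (-t) x, ?_⟩
  ext k
  rw [planeRot, planeRot_apply_fst hij, planeRot_apply_snd hij]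
  simp only [planeRot, PiLp.add_apply, PiLp.smul_apply, smul_eq_mul, Real.cos_neg, Real.sin_neg]
  linear_combination (x i * basisVec i k + x j * basisVec j k) * Real.sin_sq_add_cos_sq t

theorem measurePreserving_planeRot (hij : i ≠ j) (s t : ℝ) :
    MeasurePreserving (planeRot i j t) (μH[s].restrict (sphere (0 : Euc N) 1))
      (μH[s].restrict (sphere (0 : Euc N) 1)) := by
  have hiso := isometry_planeRot hij t
  have h : MeasurePreserving (planeRot i j t) (μH[s] : Measure (Euc N)) μH[s] := by
    refine ⟨hiso.continuous.measurable, ?_⟩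
    rw [hiso.map_hausdorffMeasure (Or.inr (surjective_planeRot hij t)),
      (surjective_planeRot hij t).range_eq, Measure.restrict_univ]
  convert h.restrict_preimage (isClosed_sphere (x := (0 : Euc N)) (ε := 1)).measurableSet using 2
  ext x
  simp [norm_planeRot hij]

end PlaneRot

theorem hausdorffMeasure_rotation_orbit {N : ℕ} {i j : Fin N} (hij : i ≠ j) {s : ℝ}
    (hfin : μH[s] (sphere (0 : Euc N) 1) ≠ ∞) {F : Euc N → ℝ} (hF : Measurable F)
    {k : ℕ} (hk : k ≠ 0)
    (hrot : ∀ x, ∃ a, ∀ t, F (planeRot i j t x) = (x i ^ 2 + x j ^ 2) ^ 2 * Real.cos (k * t + a))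
    {B : Set ℝ} (hB : MeasurableSet B) :
    2 * Real.pi * (μH[s].restrict (sphere (0 : Euc N) 1)).real (F ⁻¹' B) =
      ∫ x in sphere (0 : Euc N) 1, (∫ t in (0 : ℝ)..2 * Real.pi,
        B.indicator 1 ((x i ^ 2 + x j ^ 2) ^ 2 * Real.cos t)) ∂μH[s] := by
  set ν := (μH[s] : Measure (Euc N)).restrict (sphere (0 : Euc N) 1) with hν
  have : IsFiniteMeasure ν := ⟨by simpa [hν] using hfin.lt_top⟩
  set G : ℝ → ℝ := B.indicator 1 with hG
  have hGm : Measurable G := measurable_one.indicator hB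
  have hGb : ∀ x, ‖G x‖ ≤ 1 := fun x => by
    by_cases hx : x ∈ B <;> simp [hG, hx]
  have hrotm : Measurable fun p : ℝ × Euc N => planeRot i j p.1 p.2 := by
    unfold planeRot; fun_prop
  have h1 (t : ℝ) : ∫ x, G (F (planeRot i j t x)) ∂ν = ν.real (F ⁻¹' B) := by
    have hmp := measurePreserving_planeRot hij s t
    rw [← hν] at hmp
    rw [← integral_map (φ := planeRot i j t) (f := fun x => G (F x)) hmp.measurable.aemeasurable
      (Measurable.aestronglyMeasurable (by fun_prop)), hmp.map_eq]
    rw [← integral_indicator_one (hF hB)]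
    rfl
  have h2 : ∫ t in (0 : ℝ)..2 * Real.pi, ∫ x, G (F (planeRot i j t x)) ∂ν =
      ∫ x, (∫ t in (0 : ℝ)..2 * Real.pi, G (F (planeRot i j t x))) ∂ν := by
    refine intervalIntegral_integral_swap ?_
    have : IsFiniteMeasure (volume.restrict (uIoc 0 (2 * Real.pi))) := ⟨by simp [uIoc]⟩
    refine (integrable_const (1 : ℝ)).mono' (Measurable.aestronglyMeasurable ?_)
      (.of_forall fun p => hGb _)
    exact hGm.comp (hF.comp hrotm)
  simp only [h1, intervalIntegral.integral_const, smul_eq_mul, sub_zero] at h2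
  rw [h2]
  refine integral_congr_ae (.of_forall fun x => ?_)
  obtain ⟨a, ha⟩ := hrot x
  simp only [ha]
  exact intervalIntegral_comp_mul_cos hGm hGb hk _ a

theorem exists_polar (x y : ℝ) : ∃ r a : ℝ, x = r * Real.cos a ∧ y = r * Real.sin a :=
  ⟨‖(⟨x, y⟩ : ℂ)‖, Complex.arg ⟨x, y⟩, by rw [Complex.norm_mul_cos_arg],
    by rw [Complex.norm_mul_sin_arg]⟩

theorem hausdorffMeasure_quartic_equidistributed {N : ℕ} {i j : Fin N} (hij : i ≠ j) {s : ℝ}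
    (hfin : μH[s] (sphere (0 : Euc N) 1) ≠ ∞) {B : Set ℝ} (hB : MeasurableSet B) :
    μH[s] ({x : Euc N | x i ^ 4 - x j ^ 4 ∈ B} ∩ sphere 0 1) =
      μH[s] ({x : Euc N | pertHarmonic i j x ∈ B} ∩ sphere 0 1) := by
  have h1 := hausdorffMeasure_rotation_orbit hij hfin (F := fun x => x i ^ 4 - x j ^ 4)
    (by fun_prop) two_ne_zero (fun x => by
      obtain ⟨r, a, h, h'⟩ := exists_polar (x i) (x j)
      refine ⟨2 * a, fun t => ?_⟩
      have e1 : planeRot i j t x i = r * Real.cos (t + a) := by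
        rw [planeRot_apply_fst hij, h, h', Real.cos_add]; ring
      have e2 : planeRot i j t x j = r * Real.sin (t + a) := by
        rw [planeRot_apply_snd hij, h, h', Real.sin_add]; ring
      have e3 : (r * Real.cos a) ^ 2 + (r * Real.sin a) ^ 2 = r ^ 2 := by
        linear_combination r ^ 2 * Real.sin_sq_add_cos_sq a
      have e4 : ((2 : ℕ) : ℝ) * t + 2 * a = 2 * (t + a) := by push_cast; ring
      rw [e1, e2, h, h', e3, e4, Real.cos_two_mul]
      linear_combination (r ^ 4 * (Real.cos (t + a) ^ 2 - Real.sin (t + a) ^ 2 - 1)) *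
        Real.sin_sq_add_cos_sq (t + a)) hB
  have h2 := hausdorffMeasure_rotation_orbit hij hfin (F := pertHarmonic i j)
    (measurable_pertHarmonic i j) four_ne_zero (fun x => by
      obtain ⟨r, a, h, h'⟩ := exists_polar (x i) (x j)
      refine ⟨4 * a, fun t => ?_⟩
      have e1 : planeRot i j t x i = r * Real.cos (t + a) := by
        rw [planeRot_apply_fst hij, h, h', Real.cos_add]; ring
      have e2 : planeRot i j t x j = r * Real.sin (t + a) := by
        rw [planeRot_apply_snd hij, h, h', Real.sin_add]; ring
      have e3 : (r * Real.cos a) ^ 2 + (r * Real.sin a) ^ 2 = r ^ 2 := by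
        linear_combination r ^ 2 * Real.sin_sq_add_cos_sq a
      have e4 : ((4 : ℕ) : ℝ) * t + 4 * a = 2 * (2 * (t + a)) := by push_cast; ring
      have e5 : Real.sin (t + a) ^ 2 = 1 - Real.cos (t + a) ^ 2 := Real.sin_sq _
      rw [pertHarmonic, e1, e2, h, h', e3, e4, Real.cos_two_mul, Real.cos_two_mul]
      linear_combination (r ^ 4 * (Real.sin (t + a) ^ 2 + 1 - 7 * Real.cos (t + a) ^ 2)) * e5) hB
  rw [← h2] at h1
  have h3 := mul_left_cancel₀ (by positivity) h1
  have : IsFiniteMeasure ((μH[s] : Measure (Euc N)).restrict (sphere (0 : Euc N) 1)) :=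
    ⟨by simpa using hfin.lt_top⟩
  rw [measureReal_def, measureReal_def, ENNReal.toReal_eq_toReal_iff' (measure_ne_top _ _)
    (measure_ne_top _ _), Measure.restrict_apply₀', Measure.restrict_apply₀'] at h3
  · exact h3
  all_goals exact isClosed_sphere.measurableSet.nullMeasurableSet

theorem exists_abs_rpow_sub_quadratic_le (p : ℝ) :
    ∃ C > 0, ∃ δ > 0, ∀ s : ℝ, |s| ≤ δ →
      |(1 + s) ^ p - (1 + p * s + p * (p - 1) / 2 * s ^ 2)| ≤ C * |s| ^ 3 := by
  have h := (Real.one_add_rpow_hasFPowerSeriesAt_zero (a := p)).isBigO_sub_partialSum_pow 3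
  obtain ⟨C, hC, h⟩ := h.exists_pos
  obtain ⟨δ, hδ, h⟩ := Metric.eventually_nhds_iff_ball.1 h.bound
  refine ⟨C, hC, δ / 2, by positivity, fun s hs => ?_⟩
  have h2 : Ring.choose p 2 = p * (p - 1) / 2 := by
    have := Ring.descPochhammer_eq_factorial_smul_choose p 2
    rw [Polynomial.descPochhammer_smeval_eq_ascPochhammer,
      Polynomial.ascPochhammer_smeval_eq_eval] at this
    simp [ascPochhammer_succ_right] at this
    linarith
  have := h s (by simp; linarith)
  simpa [FormalMultilinearSeries.partialSum, Finset.sum_range_succ, binomialSeries, h2, mul_comm] using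
    this

theorem abs_sphInt_le {N : ℕ} {f : C(sphere (0 : Euc N) 1, ℝ)} {M : ℝ} (h : ∀ u, |f u| ≤ M) :
    |sphInt N f| ≤ M * sphInt N 1 := by
  have := norm_integral_le_of_norm_le_const (μ := (volume : Measure (Euc N)).toSphere)
    (f := f) (.of_forall h)
  refine this.trans_eq ?_
  change _ = M * ∫ _, (1 : ℝ) ∂_
  simp

theorem exists_sphInt_rpow_ne {N : ℕ} [NeZero N] {p : ℝ} (hp0 : p ≠ 0) (hp1 : p ≠ 1)
    {f₁ f₂ : C(sphere (0 : Euc N) 1, ℝ)} (h₁ : sphInt N f₁ = sphInt N f₂)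
    (h₂ : sphInt N (f₁ ^ 2) ≠ sphInt N (f₂ ^ 2)) :
    ∃ ε₀ > 0, ∀ ε, 0 < ε → ε ≤ ε₀ → ∀ g₁ g₂ : C(sphere (0 : Euc N) 1, ℝ),
      (∀ u, g₁ u = (1 + ε * f₁ u) ^ p) → (∀ u, g₂ u = (1 + ε * f₂ u) ^ p) →
      sphInt N g₁ ≠ sphInt N g₂ := by
  obtain ⟨C, hC, δ, hδ, hT⟩ := exists_abs_rpow_sub_quadratic_le p
  set V := sphInt N 1
  have hV : 0 < V := sphInt_one_pos
  set M := max ‖f₁‖ ‖f₂‖ + 1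
  have hM : 0 < M := by positivity
  set a := p * (p - 1) / 2
  have ha : a ≠ 0 := by
    have := sub_ne_zero.2 hp1
    positivity
  set D := |a * (sphInt N (f₁ ^ 2) - sphInt N (f₂ ^ 2))|
  have hD : 0 < D := abs_pos.2 (mul_ne_zero ha (sub_ne_zero.2 h₂))
  have hexp (f : C(sphere (0 : Euc N) 1, ℝ)) (hf : ‖f‖ ≤ M) (ε : ℝ) (hε : 0 < ε) (hεδ : ε * M ≤ δ)
      (g : C(sphere (0 : Euc N) 1, ℝ)) (hg : ∀ u, g u = (1 + ε * f u) ^ p) :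
      |sphInt N g - (V + p * ε * sphInt N f + a * ε ^ 2 * sphInt N (f ^ 2))| ≤
        C * (ε * M) ^ 3 * V := by
    have := abs_sphInt_le (f := g - ((1 : C(sphere (0 : Euc N) 1, ℝ)) + (p * ε) • f +
      (a * ε ^ 2) • f ^ 2)) (M := C * (ε * M) ^ 3) (fun u => by
        have hu : |ε * f u| ≤ ε * M := by
          rw [abs_mul, abs_of_pos hε]
          gcongr
          exact (f.norm_coe_le_norm u).trans hf
        have h := hT (ε * f u) (hu.trans hεδ)
        simp only [ContinuousMap.sub_apply, ContinuousMap.add_apply, ContinuousMap.smul_apply,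
          ContinuousMap.pow_apply, ContinuousMap.one_apply, hg, smul_eq_mul]
        rw [show (1 + p * ε * f u + a * ε ^ 2 * f u ^ 2) =
          1 + p * (ε * f u) + a * (ε * f u) ^ 2 by ring]
        exact h.trans (by gcongr))
    simpa only [map_sub, map_add, map_smul, smul_eq_mul] using this
  refine ⟨min (δ / M) (D / (4 * C * M ^ 3 * V)), by positivity, fun ε hε hε' g₁ g₂ hg₁ hg₂ he => ?_⟩
  obtain ⟨hε1, hε2⟩ := le_min_iff.1 hε'
  rw [le_div_iff₀ hM] at hε1
  rw [le_div_iff₀ (by positivity)] at hε2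
  have e1 := hexp f₁ (by simp [M]; linarith [le_max_left ‖f₁‖ ‖f₂‖]) ε hε hε1 g₁ hg₁
  have e2 := hexp f₂ (by simp [M]; linarith [le_max_right ‖f₁‖ ‖f₂‖]) ε hε hε1 g₂ hg₂
  have e3 := (abs_sub _ _).trans (add_le_add e2 e1)
  rw [he, h₁] at e3
  have e4 : ε ^ 2 * D ≤ 2 * (C * (ε * M) ^ 3 * V) := by
    rw [← abs_of_pos (pow_pos hε 2), ← abs_mul]
    calc _ ≤ _ := le_of_eq (by congr 1; ring)
      _ ≤ _ := e3
      _ = _ := by ring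
  have : ε ^ 2 * D ≤ ε ^ 2 * (D / 2) := by
    calc _ ≤ _ := e4
      _ = ε ^ 2 * (ε * (4 * C * M ^ 3 * V) / 2) := by ring
      _ ≤ _ := by gcongr
  have := le_of_mul_le_mul_left this (by positivity)
  linarith

section Variance

variable {N : ℕ} [NeZero N] {i j : Fin N}

theorem sphInt_pertOdd (hij : i ≠ j) (κ : ℝ) {f : C(sphere (0 : Euc N) 1, ℝ)}
    (hf : ∀ u, f u = pertOdd i j κ u) :
    sphInt N f = 0 ∧ sphInt N (f ^ 2) = 64 / 35 * sphMoment N 4 - 16 / 5 * κ * sphMoment N 3 +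
      4 / 3 * κ ^ 2 * sphMoment N 2 := by
  have a1 := sphInt_coord_pow i 1
  have b1 := sphInt_coord_pow j 1
  have a2 := sphInt_coord_pow i 2
  have b2 := sphInt_coord_pow j 2
  have a3 := sphInt_coord_pow i 3
  have b3 := sphInt_coord_pow j 3
  have a4 := sphInt_coord_pow i 4
  have b4 := sphInt_coord_pow j 4
  have c2 := sphInt_two_two hij
  have c3 := sphInt_four_two hij
  have d3 := sphInt_four_two hij.symm
  obtain ⟨-, c4⟩ := sphInt_six_two_and_four_four hij
  set x := sphForm (basisVec i) with hx
  set y := sphForm (basisVec j) with hy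
  have hf' : f = x ^ 4 - y ^ 4 - κ • (x ^ 2 - y ^ 2) := by
    ext u
    simp [hf, hx, hy, sphForm, inner_basisVec, pertOdd]
  have hf2 : f ^ 2 = x ^ 8 + y ^ 8 - (2 : ℝ) • (x ^ 4 * y ^ 4) -
      (2 * κ) • (x ^ 6 - x ^ 4 * y ^ 2 - y ^ 4 * x ^ 2 + y ^ 6) +
      κ ^ 2 • (x ^ 4 - (2 : ℝ) • (x ^ 2 * y ^ 2) + y ^ 4) := by
    rw [hf']; ext u; simp; ring
  rw [hf2, hf']
  simp only [map_add, map_sub, map_smul, smul_eq_mul]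
  norm_num at *
  simp only [a1, b1, a2, b2, a3, b3, a4, b4, c2, c3, d3, c4]
  constructor <;> ring

theorem sphInt_pertHarmonic (hij : i ≠ j) {f : C(sphere (0 : Euc N) 1, ℝ)}
    (hf : ∀ u, f u = pertHarmonic i j u) :
    sphInt N f = 0 ∧ sphInt N (f ^ 2) = 64 / 35 * sphMoment N 4 := by
  have a2 := sphInt_coord_pow i 2
  have b2 := sphInt_coord_pow j 2
  have a4 := sphInt_coord_pow i 4
  have b4 := sphInt_coord_pow j 4
  have c2 := sphInt_two_two hij
  obtain ⟨c4, d4⟩ := sphInt_six_two_and_four_four hij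
  obtain ⟨e4, -⟩ := sphInt_six_two_and_four_four hij.symm
  set x := sphForm (basisVec i) with hx
  set y := sphForm (basisVec j) with hy
  have hf' : f = x ^ 4 - (6 : ℝ) • (x ^ 2 * y ^ 2) + y ^ 4 := by
    ext u
    simp [hf, hx, hy, sphForm, inner_basisVec, pertHarmonic]
    ring
  have hf2 : f ^ 2 = x ^ 8 + y ^ 8 + (38 : ℝ) • (x ^ 4 * y ^ 4) -
      (12 : ℝ) • (x ^ 6 * y ^ 2 + y ^ 6 * x ^ 2) := by
    rw [hf']; ext u; simp; ring
  rw [hf2, hf']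
  simp only [map_add, map_sub, map_smul, smul_eq_mul]
  norm_num at *
  simp only [a2, b2, a4, b4, c2, c4, d4, e4]
  constructor <;> ring

end Variance

theorem sphMoment_combination_ne_zero {d : ℕ} (hd : 2 ≤ d) :
    -(16 / 5) * (6 / (d + 2) : ℝ) * sphMoment (d + 1) 3 +
      4 / 3 * (6 / (d + 2) : ℝ) ^ 2 * sphMoment (d + 1) 2 ≠ 0 := by
  have h1 := sphMoment_one (N := d + 1)
  have h2 := sphMoment_two (N := d + 1)
  have h3 := sphMoment_three (N := d + 1)
  have h0 := sphInt_one_pos (N := d + 1)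
  push_cast at *
  have hd' : (2 : ℝ) ≤ d := by exact_mod_cast hd
  have p1 : 0 < sphMoment (d + 1) 1 := by
    refine pos_of_mul_pos_right (a := (d + 1 : ℝ)) (by rw [h1]; exact h0) (by positivity)
  have p2 : 0 < sphMoment (d + 1) 2 := by
    refine pos_of_mul_pos_right (a := (d + 1 + 2 : ℝ)) (by rw [h2]; positivity) (by positivity)
  have p3 : 0 < sphMoment (d + 1) 3 := by
    refine pos_of_mul_pos_right (a := (d + 1 + 4 : ℝ)) (by rw [h3]; positivity) (by positivity)
  have e2 : sphMoment (d + 1) 2 = (d + 5) / 5 * sphMoment (d + 1) 3 := by linarith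
  have key : -(16 / 5) * (6 / (d + 2) : ℝ) * sphMoment (d + 1) 3 +
      4 / 3 * (6 / (d + 2) : ℝ) ^ 2 * sphMoment (d + 1) 2 =
      -(48 / 5) * (d - 1) * sphMoment (d + 1) 3 / (d + 2) ^ 2 := by
    rw [e2]; field_simp; ring
  rw [key]
  have : (d : ℝ) - 1 ≠ 0 := by linarith
  positivity

theorem Sdist_pertOdd_eq_pertHarmonic {d : ℕ} [NeZero d] {i j : Fin (d + 1)} (hij : i ≠ j) {ε : ℝ}
    (h₁ : ∀ u : Euc (d + 1), ‖u‖ = 1 → 0 < 1 + ε * pertOdd i j (6 / (d + 2)) u)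
    (h₂ : ∀ u : Euc (d + 1), ‖u‖ = 1 → 0 < 1 + ε * pertHarmonic i j u) (t : ℝ) :
    Sdist (d + 1) (starSet (pertRadial d (pertOdd i j (6 / (d + 2))) ε)) t =
      Sdist (d + 1) (starSet (pertRadial d (pertHarmonic i j) ε)) t := by
  unfold Sdist sphHaar
  by_cases hfin : μH[((d + 1 : ℕ) : ℝ) - 1] (sphere (0 : Euc (d + 1)) 1) = ∞
  · simp only [hfin, ENNReal.div_top]
  congr 1
  set B : Set ℝ := {y | ENNReal.ofReal t ≤
    hausdorffRatio d * ENNReal.ofReal ((sphInt d 1 + ε * (sphMoment d 2 * y)) / d)}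
  have hB : MeasurableSet B := measurableSet_le measurable_const (by fun_prop)
  convert hausdorffMeasure_quartic_equidistributed hij hfin hB using 2
  · ext θ
    refine and_congr_left fun hθ => ?_
    simp only [mem_ofPred_eq, sectionVol_pertOdd (mem_sphere_zero_iff_norm.1 hθ) i j h₁, B]
  · ext θ
    refine and_congr_left fun hθ => ?_
    simp only [mem_ofPred_eq, sectionVol_pertHarmonic (mem_sphere_zero_iff_norm.1 hθ) hij h₂, B]

theorem starSet_pertRadial_eq_neg {N d : ℕ} {f : Euc N → ℝ} (hf : ∀ x, f (-x) = f x) (ε : ℝ) :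
    starSet (pertRadial d f ε) = -starSet (pertRadial d f ε) := by
  ext x
  simp [starSet, pertRadial, hf]

theorem volume_starSet_pertRadial_ne {d : ℕ} (hd : 2 ≤ d) {i j : Fin (d + 1)} (hij : i ≠ j) :
    ∃ ε₀ > 0, ∀ ε, 0 < ε → ε ≤ ε₀ →
      (∀ u : Euc (d + 1), ‖u‖ = 1 → 0 < 1 + ε * pertOdd i j (6 / (d + 2)) u) →
      (∀ u : Euc (d + 1), ‖u‖ = 1 → 0 < 1 + ε * pertHarmonic i j u) →
      volume (starSet (pertRadial d (pertOdd i j (6 / (d + 2))) ε)) ≠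
        volume (starSet (pertRadial d (pertHarmonic i j) ε)) := by
  have hd0 : (0 : ℝ) < d := by positivity
  let p : ℝ := ((d + 1 : ℕ) : ℝ) / d
  have hp0 : p ≠ 0 := by positivity
  have hp1 : p ≠ 1 := by
    simp only [p, ne_eq, div_eq_one_iff_eq hd0.ne']
    simp
  let f₁ : C(sphere (0 : Euc (d + 1)) 1, ℝ) :=
    ⟨fun u => pertOdd i j (6 / (d + 2)) u, by unfold pertOdd; fun_prop⟩
  let f₂ : C(sphere (0 : Euc (d + 1)) 1, ℝ) :=
    ⟨fun u => pertHarmonic i j u, by unfold pertHarmonic; fun_prop⟩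
  obtain ⟨a₁, b₁⟩ := sphInt_pertOdd hij (6 / (d + 2)) (f := f₁) (fun _ => rfl)
  obtain ⟨a₂, b₂⟩ := sphInt_pertHarmonic hij (f := f₂) (fun _ => rfl)
  obtain ⟨ε₀, hε₀, H⟩ := exists_sphInt_rpow_ne hp0 hp1 (a₁.trans a₂.symm) (by
    rw [b₁, b₂]
    intro h
    refine sphMoment_combination_ne_zero hd ?_
    linear_combination h)
  refine ⟨ε₀, hε₀, fun ε hε hε' h₁ h₂ => ?_⟩
  have hpos₁ (u : sphere (0 : Euc (d + 1)) 1) : 0 < 1 + ε * f₁ u := h₁ u (by simp)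
  have hpos₂ (u : sphere (0 : Euc (d + 1)) 1) : 0 < 1 + ε * f₂ u := h₂ u (by simp)
  let g₁ : C(sphere (0 : Euc (d + 1)) 1, ℝ) := ⟨fun u => (1 + ε * f₁ u) ^ p,
    (by fun_prop : Continuous fun u => 1 + ε * f₁ u).rpow_const fun u => Or.inl (hpos₁ u).ne'⟩
  let g₂ : C(sphere (0 : Euc (d + 1)) 1, ℝ) := ⟨fun u => (1 + ε * f₂ u) ^ p,
    (by fun_prop : Continuous fun u => 1 + ε * f₂ u).rpow_const fun u => Or.inl (hpos₂ u).ne'⟩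
  rw [volume_starSet_pertRadial (measurable_pertOdd ..) h₁ g₁ (fun _ => rfl),
    volume_starSet_pertRadial (measurable_pertHarmonic ..) h₂ g₂ (fun _ => rfl)]
  have hnonneg {g : C(sphere (0 : Euc (d + 1)) 1, ℝ)} (hg : ∀ u, 0 ≤ g u) :
      0 ≤ sphInt (d + 1) g / (d + 1 : ℕ) := div_nonneg (integral_nonneg hg) (by positivity)
  rw [Ne, ENNReal.ofReal_eq_ofReal_iff (hnonneg fun u => Real.rpow_nonneg (hpos₁ u).le _)
    (hnonneg fun u => Real.rpow_nonneg (hpos₂ u).le _), div_left_inj' (by positivity)]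
  exact H ε hε hε' g₁ g₂ (fun _ => rfl) (fun _ => rfl)

/-- For every `n ≥ 3` there are origin-symmetric convex bodies in `ℝⁿ` with
the same distribution function of areas of central sections but different volumes. -/
theorem stmt_12 (n : ℕ) (hn : 3 ≤ n) : ∃ K L : Set (Euc n),
    IsConvexBody K ∧ IsConvexBody L ∧ K = -K ∧ L = -L ∧
    (∀ t : ℝ, 0 ≤ t → Sdist n K t = Sdist n L t) ∧
    volume K ≠ volume L := by
  obtain ⟨d, rfl⟩ : ∃ d, n = d + 1 := ⟨n - 1, by omega⟩
  have hd : 2 ≤ d := by omega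
  have : NeZero d := ⟨by omega⟩
  have hij : (0 : Fin (d + 1)) ≠ Fin.last d := (Fin.last_pos' (n := d)).ne
  set i : Fin (d + 1) := 0
  set j : Fin (d + 1) := Fin.last d
  obtain ⟨ε₁, hε₁, H₁⟩ :=
    (hasSphTaylor_pertOdd i j (6 / (d + 2))).exists_isConvexBody (NeZero.ne d) (by simp [pertOdd])
  obtain ⟨ε₂, hε₂, H₂⟩ :=
    (hasSphTaylor_pertHarmonic i j).exists_isConvexBody (NeZero.ne d) (by simp [pertHarmonic])
  obtain ⟨ε₃, hε₃, H₃⟩ := volume_starSet_pertRadial_ne hd hij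
  let ε := min ε₁ (min ε₂ ε₃)
  have hε : 0 < ε := by positivity
  obtain ⟨b₁, c₁⟩ := H₁ ε hε (min_le_left _ _)
  obtain ⟨b₂, c₂⟩ := H₂ ε hε ((min_le_right _ _).trans (min_le_left _ _))
  have hpos {f : Euc (d + 1) → ℝ} (h : ∀ u, ‖u‖ = 1 → |ε * f u| ≤ 1 / 2) (u : Euc (d + 1))
      (hu : ‖u‖ = 1) : 0 < 1 + ε * f u := by
    linarith [(abs_le.1 (h u hu)).1]
  exact ⟨_, _, c₁, c₂,
    starSet_pertRadial_eq_neg (fun x => by simp only [pertOdd, PiLp.neg_apply]; ring) ε,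
    starSet_pertRadial_eq_neg (fun x => by simp only [pertHarmonic, PiLp.neg_apply]; ring) ε,
    fun t _ => Sdist_pertOdd_eq_pertHarmonic hij (hpos b₁) (hpos b₂) t,
    H₃ ε hε ((min_le_right _ _).trans (min_le_right _ _)) (hpos b₁) (hpos b₂)⟩
end
end

section
/- For every n ≥ 2 there exist origin-symmetric convex bodies K and L in R^n such that Π_K(t) = Π_L(t) for all t ≥ 0, but |K| ≠ |L|. That is, the distribution function of the volumes of orthogonal hyperplane projections does not determine the volume of an origin-symmetric convex body. -/
open MeasureTheory Metric Set
open scoped RealInnerProductSpace ENNReal NNReal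

noncomputable section

/-- The set swept out by `K` under translation by `τ • v`, `0 ≤ τ ≤ s`. -/
def sweep {V : Type*} [AddCommGroup V] [Module ℝ V] (K : Set V) (v : V) (s : ℝ) : Set V :=
  {x | ∃ τ ∈ Icc 0 s, x - τ • v ∈ K}

/-- The volume of the swept set grows linearly, with slope `g`. -/
def HasRate {V : Type*} [AddCommGroup V] [Module ℝ V] [MeasureSpace V] (K : Set V) (v : V)
    (g : ℝ≥0∞) : Prop :=
  ∀ s : ℝ, 0 ≤ s → volume (sweep K v s) = volume K + ENNReal.ofReal s * g

section Sweep

variable {V : Type*} [NormedAddCommGroup V] [NormedSpace ℝ V]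

lemma sweep_eq_image (K : Set V) (v : V) (s : ℝ) :
    sweep K v s = (fun p : ℝ × V => p.2 + p.1 • v) '' (Icc 0 s ×ˢ K) := by
  ext x
  constructor
  · rintro ⟨τ, hτ, hx⟩
    exact ⟨(τ, x - τ • v), ⟨hτ, hx⟩, by simp⟩
  · rintro ⟨⟨τ, y⟩, ⟨hτ, hy⟩, rfl⟩
    exact ⟨τ, hτ, by simpa using hy⟩

lemma IsCompact.sweep {K : Set V} (hK : IsCompact K) (v : V) (s : ℝ) :
    IsCompact (sweep K v s) := by
  rw [sweep_eq_image]
  exact (isCompact_Icc.prod hK).image (by fun_prop)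

lemma sweep_zero_vec (K : Set V) {s : ℝ} (hs : 0 ≤ s) : sweep K 0 s = K := by
  ext x
  constructor
  · rintro ⟨τ, -, hx⟩
    simpa using hx
  · intro hx
    exact ⟨0, ⟨le_rfl, hs⟩, by simpa using hx⟩

lemma sweep_smul_vec (K : Set V) (v : V) {r : ℝ} (hr : 0 < r) (s : ℝ) :
    sweep K (r • v) s = sweep K v (r * s) := by
  ext x
  constructor
  · rintro ⟨τ, hτ, hx⟩
    refine ⟨r * τ, ⟨mul_nonneg hr.le hτ.1, mul_le_mul_of_nonneg_left hτ.2 hr.le⟩, ?_⟩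
    rwa [mul_comm, mul_smul]
  · rintro ⟨τ, hτ, hx⟩
    refine ⟨τ / r, ⟨div_nonneg hτ.1 hr.le, ?_⟩, ?_⟩
    · rw [div_le_iff₀ hr, mul_comm]
      exact hτ.2
    · rwa [smul_smul, div_mul_cancel₀ _ hr.ne']

variable [MeasureSpace V]

lemma HasRate.smul_vec {K : Set V} {v : V} {g : ℝ≥0∞} (h : HasRate K v g) {r : ℝ} (hr : 0 ≤ r) :
    HasRate K (r • v) (ENNReal.ofReal r * g) := by
  intro s hs
  rcases hr.eq_or_lt with rfl | hr'
  · simp [sweep_zero_vec K hs]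
  · rw [sweep_smul_vec K v hr', h _ (by positivity), ENNReal.ofReal_mul hr]
    ring

lemma HasRate.unique {K : Set V} {v : V} {g g' : ℝ≥0∞} (h : HasRate K v g) (h' : HasRate K v g')
    (hK : volume K ≠ ⊤) : g = g' := by
  have := (h 1 zero_le_one).symm.trans (h' 1 zero_le_one)
  simpa [ENNReal.add_right_inj hK] using this

lemma HasRate.preimage {V' : Type*} [NormedAddCommGroup V'] [NormedSpace ℝ V'] [MeasureSpace V']
    (e : V ≃ₗ[ℝ] V') (he : MeasurePreserving e) {K : Set V'}
    (hK : ∀ v s, MeasurableSet (sweep K v s))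
    {v : V} {g : ℝ≥0∞} (h : HasRate K (e v) g) : HasRate (e ⁻¹' K) v g := by
  have hK' : MeasurableSet K := by simpa [sweep_zero_vec K le_rfl] using hK 0 0
  intro s hs
  have : sweep (e ⁻¹' K) v s = e ⁻¹' (sweep K (e v) s) := by
    ext x
    simp [sweep]
  rw [this, he.measure_preimage (hK _ _).nullMeasurableSet,
    he.measure_preimage hK'.nullMeasurableSet, h s hs]

lemma HasRate.smul [BorelSpace V] [FiniteDimensional ℝ V] [(volume : Measure V).IsAddHaarMeasure]
    {K : Set V} {v : V} {g : ℝ≥0∞} (h : HasRate K v g) {b : ℝ} (hb : 0 < b) :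
    HasRate ((b • ·) '' K) v (ENNReal.ofReal (b ^ Module.finrank ℝ V * b⁻¹) * g) := by
  intro s hs
  have : sweep ((b • ·) '' K) v s = (b • ·) '' (sweep K v (b⁻¹ * s)) := by
    rw [← sweep_smul_vec K v (inv_pos.2 hb)]
    ext x
    simp only [sweep, mem_ofPred_eq, mem_image]
    constructor
    · rintro ⟨τ, hτ, y, hy, hxy⟩
      refine ⟨b⁻¹ • x, ⟨τ, hτ, ?_⟩, ?_⟩
      · rw [smul_comm, ← smul_sub, ← hxy, inv_smul_smul₀ hb.ne']
        exact hy
      · rw [smul_inv_smul₀ hb.ne']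
    · rintro ⟨y, ⟨τ, hτ, hy⟩, rfl⟩
      refine ⟨τ, hτ, _, hy, ?_⟩
      rw [smul_sub, smul_comm, smul_inv_smul₀ hb.ne']
  rw [this, image_smul, image_smul, Measure.addHaar_smul_of_nonneg _ hb.le,
    Measure.addHaar_smul_of_nonneg _ hb.le, h _ (by positivity), mul_add, ENNReal.ofReal_mul
    (by positivity), ENNReal.ofReal_mul (by positivity)]
  ring

end Sweep

lemma volume_Icc_sweep {K : Set ℝ} (hK : IsCompact K) (hc : Convex ℝ K) (hne : K.Nonempty)
    {s : ℝ} (hs : 0 ≤ s) : volume (sweep K 1 s) = volume K + ENNReal.ofReal s := by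
  obtain ⟨a, b, hab⟩ : ∃ a b, K = Icc a b :=
    ⟨_, _, eq_Icc_of_connected_compact (hc.isConnected hne) hK⟩
  have hle : a ≤ b := by
    rw [hab] at hne
    exact nonempty_Icc.1 hne
  have : sweep K 1 s = Icc a (b + s) := by
    ext x
    simp only [sweep, hab, mem_ofPred_eq, mem_Icc, smul_eq_mul, mul_one]
    constructor
    · rintro ⟨τ, h1, h2⟩
      constructor <;> linarith
    · rintro ⟨h1, h2⟩
      rcases le_total x b with h | h
      · exact ⟨0, ⟨le_rfl, hs⟩, by simp [h1, h]⟩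
      · exact ⟨x - b, ⟨by linarith, by linarith⟩, by linarith, by linarith⟩
  rw [this, hab, Real.volume_Icc, Real.volume_Icc, ← ENNReal.ofReal_add (by linarith) hs]
  ring_nf

section Product

variable {V W : Type*} [NormedAddCommGroup V] [NormedSpace ℝ V] [MeasureSpace V] [BorelSpace V]
  [NormedAddCommGroup W] [NormedSpace ℝ W] [MeasureSpace W] [BorelSpace W]
  [SecondCountableTopology W]
  [SFinite (volume : Measure V)] [SFinite (volume : Measure W)]

lemma hasRate_fst {K : Set (ℝ × W)} (hK : IsCompact K) (hc : Convex ℝ K) :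
    HasRate K (1, 0) (volume (Prod.snd '' K)) := by
  intro s hs
  have hP : MeasurableSet (Prod.snd '' K) := (hK.image continuous_snd).measurableSet
  have hfib : ∀ w, volume ((fun x => (x, w)) ⁻¹' (sweep K (1, 0) s)) =
      volume ((fun x => (x, w)) ⁻¹' K) +
        (Prod.snd '' K).indicator (fun _ => ENNReal.ofReal s) w := by
    intro w
    have h1 : (fun x => (x, w)) ⁻¹' (sweep K (1, 0) s) =
        sweep ((fun x : ℝ => (x, w)) ⁻¹' K) 1 s := by
      ext x
      simp [sweep]
    rw [h1]
    by_cases hw : w ∈ Prod.snd '' K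
    · rw [indicator_of_mem hw]
      refine volume_Icc_sweep ?_ ?_ ?_ hs
      · refine (hK.image continuous_fst).of_isClosed_subset
          (hK.isClosed.preimage (by fun_prop)) fun x hx => ⟨_, hx, rfl⟩
      · intro x hx y hy a b ha hb hab
        have := hc hx hy ha hb hab
        simpa [← add_smul, hab] using this
      · obtain ⟨⟨x, y⟩, hx, rfl⟩ := hw
        exact ⟨x, hx⟩
    · rw [indicator_of_notMem hw]
      have h0 : (fun x : ℝ => (x, w)) ⁻¹' K = ∅ := by
        ext x
        simp only [mem_preimage, mem_empty_iff_false, iff_false]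
        exact fun hx => hw ⟨_, hx, rfl⟩
      simp [h0, sweep]
  rw [Measure.volume_eq_prod, Measure.prod_apply_symm (hK.sweep _ _).measurableSet,
    Measure.prod_apply_symm hK.measurableSet]
  simp_rw [hfib]
  rw [lintegral_add_right _ (measurable_const.indicator hP), lintegral_indicator_const hP]

lemma HasRate.prod {K : Set V} {Q : Set W} (hK : IsCompact K) (hQ : IsCompact Q)
    (hQc : Convex ℝ Q) {v : V} {w : W} {g g' : ℝ≥0∞} [(volume : Measure V).IsAddLeftInvariant]
    [(volume : Measure W).IsAddLeftInvariant] (hv : HasRate K v g) (hw : HasRate Q w g') :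
    HasRate (K ×ˢ Q) (v, w) (volume Q * g + volume K * g') := by
  intro s hs
  set E : Set (ℝ × W) := {p | p.1 ∈ Icc 0 s ∧ p.2 - p.1 • w ∈ Q} with hE
  have hEm : MeasurableSet E := by
    have : IsClosed E := (isClosed_Icc.preimage continuous_fst).inter
      (hQ.isClosed.preimage (by fun_prop : Continuous fun p : ℝ × W => p.2 - p.1 • w))
    exact this.measurableSet
  have hE_vol : ∫⁻ y, volume ((fun τ => (τ, y)) ⁻¹' E) = ENNReal.ofReal s * volume Q := by
    rw [← Measure.prod_apply_symm hEm, Measure.prod_apply hEm]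
    have : ∀ τ : ℝ, volume (Prod.mk τ ⁻¹' E) = (Icc 0 s).indicator (fun _ => volume Q) τ := by
      intro τ
      by_cases hτ : τ ∈ Icc 0 s
      · rw [indicator_of_mem hτ]
        have : Prod.mk τ ⁻¹' E = (fun y => -(τ • w) + y) ⁻¹' Q := by
          ext y
          simp only [hE, mem_preimage, mem_ofPred_eq, hτ, true_and]
          rw [sub_eq_neg_add]
        rw [this, measure_preimage_add]
      · rw [indicator_of_notMem hτ]
        have : Prod.mk τ ⁻¹' E = ∅ := by
          ext y
          simp only [hE, mem_preimage, mem_ofPred_eq, hτ, false_and, mem_empty_iff_false]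
        simp [this]
    simp_rw [this]
    rw [lintegral_indicator_const measurableSet_Icc, Real.volume_Icc, sub_zero, mul_comm]
  have hS := (hQ.sweep w s).measurableSet
  have hfib : ∀ y, volume ((fun x => (x, y)) ⁻¹' (sweep (K ×ˢ Q) (v, w) s)) =
      (sweep Q w s).indicator (fun _ => volume K) y + volume ((fun τ => (τ, y)) ⁻¹' E) * g := by
    intro y
    by_cases hy : y ∈ sweep Q w s
    · rw [indicator_of_mem hy]
      have hJc : IsCompact ((fun τ => (τ, y)) ⁻¹' E) := by
        have : IsClosed ((fun τ : ℝ => y - τ • w) ⁻¹' Q) := hQ.isClosed.preimage (by fun_prop)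
        exact isCompact_Icc.inter_right this
      have hJv : Convex ℝ ((fun τ => (τ, y)) ⁻¹' E) := by
        intro x hx z hz a b ha hb hab
        refine ⟨convex_Icc 0 s hx.1 hz.1 ha hb hab, ?_⟩
        have := hQc hx.2 hz.2 ha hb hab
        convert this using 1
        have : y = a • y + b • y := by rw [← add_smul, hab, one_smul]
        conv_lhs => rw [this]
        simp only [smul_eq_mul]
        module
      have hJn : ((fun τ => (τ, y)) ⁻¹' E).Nonempty := by
        obtain ⟨τ, h1, h2⟩ := hy
        exact ⟨τ, h1, h2⟩
      obtain ⟨a, b, hab⟩ : ∃ a b, (fun τ => (τ, y)) ⁻¹' E = Icc a b :=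
        ⟨_, _, eq_Icc_of_connected_compact (hJv.isConnected hJn) hJc⟩
      have hle : a ≤ b := by
        rw [hab] at hJn
        exact nonempty_Icc.1 hJn
      have h1 : (fun x => (x, y)) ⁻¹' (sweep (K ×ˢ Q) (v, w) s) =
          (fun x => -(a • v) + x) ⁻¹' (sweep K v (b - a)) := by
        ext x
        have key : ∀ τ, (τ ∈ Icc 0 s ∧ y - τ • w ∈ Q) ↔ τ ∈ Icc a b := by
          intro τ
          rw [← hab]
          rfl
        constructor
        · rintro ⟨τ, hτ, hx, hq⟩
          have := (key τ).1 ⟨hτ, hq⟩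
          refine ⟨τ - a, ⟨by linarith [this.1], by linarith [this.2]⟩, ?_⟩
          convert hx using 1
          simp only [Prod.fst_sub, Prod.smul_fst]
          module
        · rintro ⟨τ, hτ, hx⟩
          obtain ⟨h3, h4⟩ := (key (τ + a)).2 ⟨by linarith [hτ.1], by linarith [hτ.2]⟩
          refine ⟨τ + a, h3, ?_, h4⟩
          convert hx using 1
          simp only [Prod.fst_sub, Prod.smul_fst]
          module
      rw [h1, measure_preimage_add, hv _ (by linarith), hab, Real.volume_Icc]
    · rw [indicator_of_notMem hy]
      have h0 : (fun τ => (τ, y)) ⁻¹' E = ∅ := by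
        ext τ
        simp only [mem_preimage, mem_empty_iff_false, iff_false]
        exact fun h => hy ⟨τ, h.1, h.2⟩
      have h1 : (fun x => (x, y)) ⁻¹' (sweep (K ×ˢ Q) (v, w) s) = ∅ := by
        ext x
        simp only [mem_preimage, mem_empty_iff_false, iff_false]
        rintro ⟨τ, hτ, hx⟩
        exact hy ⟨τ, hτ, hx.2⟩
      simp [h0, h1]
  rw [Measure.volume_eq_prod, Measure.prod_apply_symm ((hK.prod hQ).sweep _ _).measurableSet,
    Measure.prod_prod]
  simp_rw [hfib]
  rw [lintegral_add_left (measurable_const.indicator hS), lintegral_indicator_const hS,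
    lintegral_mul_const _ (measurable_measure_prodMk_right hEm), hE_vol, hw s hs]
  ring

end Product

/-- Splitting off the first coordinate of `ℝ^(k+1)`. -/
def consEquiv (k : ℕ) : Euc (k + 1) ≃ₗ[ℝ] ℝ × Euc k where
  toFun x := (x 0, WithLp.toLp 2 fun i => x i.succ)
  map_add' x y := by ext <;> simp
  map_smul' c x := by ext <;> simp
  invFun p := WithLp.toLp 2 (Fin.cons p.1 fun i => p.2 i)
  left_inv x := by
    ext i
    refine Fin.cases ?_ (fun j => ?_) i <;> simp
  right_inv p := by ext <;> simp

lemma measurePreserving_consEquiv (k : ℕ) : MeasurePreserving (consEquiv k) := by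
  have h1 := PiLp.volume_preserving_ofLp (Fin (k + 1))
  have h2 := volume_preserving_piFinSuccAbove (fun _ : Fin (k + 1) => ℝ) 0
  have h3 := (MeasurePreserving.id (volume : Measure ℝ)).prod (PiLp.volume_preserving_toLp (Fin k))
  exact (h3.comp h2).comp h1

lemma norm_sq_eq_consEquiv {k : ℕ} (x : Euc (k + 1)) :
    ‖x‖ ^ 2 = (consEquiv k x).1 ^ 2 + ‖(consEquiv k x).2‖ ^ 2 := by
  simp [EuclideanSpace.norm_sq_eq, Fin.sum_univ_succ, consEquiv]

lemma exists_hasRate_projVol (k : ℕ) : ∃ C : ℝ≥0∞, ∀ (K : Set (Euc (k + 1))) (θ : Euc (k + 1)),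
    IsCompact K → Convex ℝ K → ‖θ‖ = 1 → ∃ g, HasRate K θ g ∧ projVol (k + 1) K θ = C * g := by
  obtain ⟨c, hc⟩ : ∃ c : ℝ≥0∞, (μH[(k : ℝ)] : Measure (Euc k)) = c • volume := by
    have h : (μH[(Module.finrank ℝ (Euc k) : ℝ)] : Measure (Euc k)).IsAddHaarMeasure :=
      inferInstance
    rw [finrank_euclideanSpace_fin] at h
    exact ⟨_, Measure.isAddLeftInvariant_eq_smul _ _⟩
  refine ⟨c, fun K θ hK hKc hθ => ?_⟩
  set e₀ : Euc (k + 1) := (consEquiv k).symm (1, 0) with he₀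
  have he₀n : ‖e₀‖ = 1 := by
    have := norm_sq_eq_consEquiv e₀
    rw [he₀, LinearEquiv.apply_symm_apply, ← he₀] at this
    simpa [(norm_nonneg e₀).trans_lt' neg_one_lt_zero |>.ne'] using this
  set R := Submodule.reflection (ℝ ∙ (θ - e₀))ᗮ with hR
  have hRθ : R θ = e₀ := Submodule.reflection_sub (hθ.trans he₀n.symm)
  set T : Euc (k + 1) ≃ₗ[ℝ] ℝ × Euc k := R.toLinearEquiv.trans (consEquiv k) with hT
  have hTp : MeasurePreserving T :=
    (measurePreserving_consEquiv k).comp (LinearIsometryEquiv.measurePreserving R)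
  have hTθ : T θ = (1, 0) := by simp [hT, hRθ, he₀]
  have hTn : ∀ x, ‖x‖ ^ 2 = (T x).1 ^ 2 + ‖(T x).2‖ ^ 2 := fun x => by
    rw [← R.norm_map x]
    exact norm_sq_eq_consEquiv (R x)
  have hT1 : ∀ x, (T x).1 = ⟪x, θ⟫ := by
    intro x
    have h1 := hTn (x + θ)
    have h2 := hTn x
    rw [map_add, hTθ] at h1
    have h3 := @norm_add_sq_real _ _ _ x θ
    simp only [Prod.fst_add, Prod.snd_add, add_zero] at h1
    rw [hθ] at h3
    linarith
  have hTc : Continuous T := T.toLinearMap.continuous_of_finiteDimensional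
  have hK' : IsCompact (T '' K) := hK.image hTc
  have hKc' : Convex ℝ (T '' K) := hKc.linear_image T.toLinearMap
  refine ⟨volume (Prod.snd '' (T '' K)), ?_, ?_⟩
  · have := hasRate_fst hK' hKc'
    rw [← hTθ] at this
    have := this.preimage T hTp fun v s => (hK'.sweep v s).measurableSet
    rwa [preimage_image_eq _ T.injective] at this
  · have hJ : Isometry fun y : Euc k => T.symm (0, y) := by
      refine Isometry.of_dist_eq fun y z => ?_
      rw [dist_eq_norm, dist_eq_norm, ← map_sub]
      have := hTn (T.symm ((0, y) - (0, z)))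
      simp only [LinearEquiv.apply_symm_apply] at this
      rw [← abs_of_nonneg (norm_nonneg (y - z)), ← abs_norm, ← sq_eq_sq_iff_abs_eq_abs, this]
      simp
    have himg : (fun x => x - ⟪x, θ⟫ • θ) '' K =
        (fun y : Euc k => T.symm (0, y)) '' (Prod.snd '' (T '' K)) := by
      rw [image_image, image_image]
      refine image_congr fun x _ => ?_
      rw [LinearEquiv.eq_symm_apply, map_sub, map_smul, hTθ, ← hT1 x]
      ext <;> simp
    unfold projVol
    rw [himg, show ((k + 1 : ℕ) : ℝ) - 1 = k by simp, hJ.hausdorffMeasure_image (by simp), hc]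
    simp

lemma exists_hasRate {m : ℕ} {Q : Set (Euc m)} (hQ : IsCompact Q) (hQc : Convex ℝ Q) (v : Euc m) :
    ∃ g, HasRate Q v g := by
  rcases eq_or_ne v 0 with rfl | hv
  · exact ⟨0, fun s hs => by simp [sweep_zero_vec Q hs]⟩
  · cases m with
    | zero => exact absurd (Subsingleton.elim v 0) hv
    | succ k =>
      obtain ⟨C, hC⟩ := exists_hasRate_projVol k
      obtain ⟨g, hg, -⟩ := hC Q (‖v‖⁻¹ • v) hQ hQc (norm_smul_inv_norm (𝕜 := ℝ) hv)
      have := hg.smul_vec (norm_nonneg v)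
      rw [smul_inv_smul₀ (norm_ne_zero_iff.2 hv)] at this
      exact ⟨_, this⟩

/-- A measurable map which is equivariant with respect to squaring and preserves the orbits of a
measure-preserving action of a compact group preserves the measure of every measurable set. -/
lemma measure_preimage_of_equivariant_sq {G X : Type*} [CommGroup G] [MeasurableSpace G]
    [MeasurableMul G] [MeasurableSpace X] (κ : Measure G) [IsProbabilityMeasure κ]
    [κ.IsMulRightInvariant] (hκ : MeasurePreserving (fun z : G => z ^ 2) κ κ)
    (ν : Measure X) [SFinite ν] {R : G → X → X} {D : X → X} (hR : Measurable (Function.uncurry R))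
    (hmul : ∀ z w x, R (z * w) x = R z (R w x)) (hν : ∀ z, MeasurePreserving (R z) ν ν)
    (hD : Measurable D) (hDR : ∀ z x, D (R z x) = R (z ^ 2) (D x)) (horb : ∀ x, ∃ w, D x = R w x)
    {A : Set X} (hA : MeasurableSet A) : ν (D ⁻¹' A) = ν A := by
  have avg : ∀ B, MeasurableSet B → ν B = ∫⁻ x, κ {z | R z x ∈ B} ∂ν := by
    intro B hB
    have hm : MeasurableSet {p : G × X | R p.1 p.2 ∈ B} := hR hB
    calc ν B = ∫⁻ z, ν {x | R z x ∈ B} ∂κ := by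
          have : ∀ z, ν {x | R z x ∈ B} = ν B := fun z =>
            (hν z).measure_preimage hB.nullMeasurableSet
          simp [this]
      _ = (κ.prod ν) {p : G × X | R p.1 p.2 ∈ B} := (Measure.prod_apply hm).symm
      _ = ∫⁻ x, κ {z | R z x ∈ B} ∂ν := Measure.prod_apply_symm hm
  rw [avg _ (hD hA), avg _ hA]
  refine lintegral_congr fun x => ?_
  obtain ⟨w, hw⟩ := horb x
  have hmx : MeasurableSet {z | R z x ∈ A} := (hR.comp measurable_prodMk_right) hA
  have hmw : MeasurableSet {z | R (z * w) x ∈ A} := (measurable_mul_const w) hmx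
  calc κ {z | R z x ∈ D ⁻¹' A} = κ ((fun z => z ^ 2) ⁻¹' {z | R (z * w) x ∈ A}) := by
        congr 1
        ext z
        simp [hDR, hw, hmul]
    _ = κ {z | R (z * w) x ∈ A} := hκ.measure_preimage hmw.nullMeasurableSet
    _ = κ {z | R z x ∈ A} := measure_preimage_mul_right κ w {z | R z x ∈ A}

/-- Splitting off the first two coordinates of `ℝ^(m+2)`. -/
def splitEquiv (m : ℕ) : Euc (m + 2) ≃ₗ[ℝ] (ℝ × ℝ) × Euc m :=
  (consEquiv (m + 1)).trans
    (((LinearEquiv.refl ℝ ℝ).prodCongr (consEquiv m)).trans (LinearEquiv.prodAssoc ℝ ℝ ℝ _).symm)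

lemma measurePreserving_splitEquiv (m : ℕ) : MeasurePreserving (splitEquiv m) := by
  have h1 := measurePreserving_consEquiv (m + 1)
  have h2 := (MeasurePreserving.id (volume : Measure ℝ)).prod (measurePreserving_consEquiv m)
  have h3 := (volume_preserving_prodAssoc (α₁ := ℝ) (β₁ := ℝ) (γ₁ := Euc m)).symm
  exact (h3.comp h2).comp h1

lemma continuous_splitEquiv (m : ℕ) : Continuous (splitEquiv m) :=
  (splitEquiv m).toLinearMap.continuous_of_finiteDimensional

lemma continuous_splitEquiv_symm (m : ℕ) : Continuous (splitEquiv m).symm :=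
  (splitEquiv m).symm.toLinearMap.continuous_of_finiteDimensional

/-- The complex number formed by the first two coordinates. -/
def planePart {m : ℕ} (x : Euc (m + 2)) : ℂ := ⟨(splitEquiv m x).1.1, (splitEquiv m x).1.2⟩

lemma norm_sq_eq_planePart {m : ℕ} (x : Euc (m + 2)) :
    ‖x‖ ^ 2 = ‖planePart x‖ ^ 2 + ‖(splitEquiv m x).2‖ ^ 2 := by
  have h : splitEquiv m x = (((consEquiv (m + 1) x).1,
    (consEquiv m (consEquiv (m + 1) x).2).1), (consEquiv m (consEquiv (m + 1) x).2).2) := rfl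
  rw [norm_sq_eq_consEquiv x, norm_sq_eq_consEquiv (consEquiv (m + 1) x).2, Complex.sq_norm,
    planePart, Complex.normSq_mk, h]
  ring

lemma continuous_planePart (m : ℕ) : Continuous (planePart : Euc (m + 2) → ℂ) := by
  have := continuous_splitEquiv m
  have h : (planePart : Euc (m + 2) → ℂ) = fun x =>
      Complex.equivRealProdCLM.symm (splitEquiv m x).1 := by
    rfl
  rw [h]
  fun_prop

/-- Apply a map of the complex plane to the first two coordinates. -/
def mapPlane {m : ℕ} (f : ℂ → ℂ) (x : Euc (m + 2)) : Euc (m + 2) :=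
  (splitEquiv m).symm (((f (planePart x)).re, (f (planePart x)).im), (splitEquiv m x).2)

lemma splitEquiv_mapPlane {m : ℕ} (f : ℂ → ℂ) (x : Euc (m + 2)) : splitEquiv m (mapPlane f x) =
    (((f (planePart x)).re, (f (planePart x)).im), (splitEquiv m x).2) := by
  simp [mapPlane]

@[simp]
lemma planePart_mapPlane {m : ℕ} (f : ℂ → ℂ) (x : Euc (m + 2)) :
    planePart (mapPlane f x) = f (planePart x) := by
  rw [planePart, splitEquiv_mapPlane]

lemma mapPlane_mapPlane {m : ℕ} (f g : ℂ → ℂ) (x : Euc (m + 2)) :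
    mapPlane f (mapPlane g x) = mapPlane (f ∘ g) x := by
  rw [mapPlane, splitEquiv_mapPlane, planePart_mapPlane]
  rfl

lemma mapPlane_congr {m : ℕ} {f g : ℂ → ℂ} {x : Euc (m + 2)}
    (h : f (planePart x) = g (planePart x)) :
    mapPlane f x = mapPlane g x := by
  simp only [mapPlane, h]

lemma norm_mapPlane {m : ℕ} {f : ℂ → ℂ} (hf : ∀ v, ‖f v‖ = ‖v‖) (x : Euc (m + 2)) :
    ‖mapPlane f x‖ = ‖x‖ := by
  have h := norm_sq_eq_planePart (mapPlane f x)
  rw [planePart_mapPlane, hf, splitEquiv_mapPlane, ← norm_sq_eq_planePart] at h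
  exact (pow_left_inj₀ (norm_nonneg _) (norm_nonneg _) two_ne_zero).1 h

lemma measurable_mapPlane {m : ℕ} {f : ℂ → ℂ} (hf : Measurable f) :
    Measurable (mapPlane f : Euc (m + 2) → Euc (m + 2)) := by
  have h1 := (continuous_planePart m).measurable
  have h2 := (continuous_splitEquiv m).measurable
  have h3 := (continuous_splitEquiv_symm m).measurable
  unfold mapPlane
  fun_prop

/-- Rotation in the plane of the first two coordinates. -/
def rotPlane {m : ℕ} (z : Circle) : Euc (m + 2) → Euc (m + 2) := mapPlane fun v => z * v

/-- The map doubling the argument in the plane of the first two coordinates. -/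
def doublePlane {m : ℕ} : Euc (m + 2) → Euc (m + 2) := mapPlane fun v => v ^ 2 / ‖v‖

lemma norm_sq_div_norm (v : ℂ) : ‖v ^ 2 / ‖v‖‖ = ‖v‖ := by
  rcases eq_or_ne v 0 with rfl | hv
  · simp
  · have : ‖v‖ ≠ 0 := norm_ne_zero_iff.2 hv
    rw [norm_div, norm_pow, Complex.norm_real, norm_norm]
    field_simp

lemma isometry_rotPlane {m : ℕ} (z : Circle) :
    Isometry (rotPlane z : Euc (m + 2) → Euc (m + 2)) := by
  refine Isometry.of_dist_eq fun x y => ?_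
  have h : rotPlane z x - rotPlane z y = rotPlane z (x - y) := by
    have hp : planePart (x - y) = planePart x - planePart y := by
      simp only [planePart, map_sub]
      rfl
    simp only [rotPlane, mapPlane, hp, ← map_sub, mul_sub]
    simp
  rw [dist_eq_norm, dist_eq_norm, h]
  exact norm_mapPlane (fun v => by rw [norm_mul, Circle.norm_coe, one_mul]) _

lemma rotPlane_mul {m : ℕ} (z w : Circle) (x : Euc (m + 2)) :
    rotPlane (z * w) x = rotPlane z (rotPlane w x) := by
  unfold rotPlane
  rw [mapPlane_mapPlane]
  exact mapPlane_congr (by simp [mul_assoc])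

lemma rotPlane_one {m : ℕ} (x : Euc (m + 2)) : rotPlane 1 x = x := by
  unfold rotPlane mapPlane
  rw [LinearEquiv.symm_apply_eq]
  simp [planePart]

lemma surjective_rotPlane {m : ℕ} (z : Circle) :
    Function.Surjective (rotPlane z : Euc (m + 2) → Euc (m + 2)) := fun x =>
  ⟨rotPlane z⁻¹ x, by rw [← rotPlane_mul, mul_inv_cancel, rotPlane_one]⟩

lemma continuous_uncurry_rotPlane (m : ℕ) :
    Continuous (Function.uncurry (rotPlane (m := m))) := by
  have h1 := continuous_planePart m
  have h2 := continuous_splitEquiv m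
  have h3 := continuous_splitEquiv_symm m
  unfold rotPlane mapPlane Function.uncurry
  fun_prop

lemma measurePreserving_rotPlane {m : ℕ} (d : ℝ) (z : Circle) :
    MeasurePreserving (rotPlane z : Euc (m + 2) → Euc (m + 2))
      (μH[d].restrict (sphere 0 1)) (μH[d].restrict (sphere 0 1)) := by
  have h : MeasurePreserving (rotPlane z : Euc (m + 2) → Euc (m + 2)) μH[d] μH[d] :=
    ⟨(isometry_rotPlane z).continuous.measurable, by
      rw [(isometry_rotPlane z).map_hausdorffMeasure (.inr (surjective_rotPlane z)),
        (surjective_rotPlane z).range_eq, Measure.restrict_univ]⟩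
  have h2 := h.restrict_preimage (isClosed_sphere (x := (0 : Euc (m + 2))) (ε := 1)).measurableSet
  have h3 : (rotPlane z : Euc (m + 2) → Euc (m + 2)) ⁻¹' sphere 0 1 = sphere 0 1 := by
    ext x
    simp only [mem_preimage, mem_sphere_zero_iff_norm, rotPlane]
    rw [norm_mapPlane fun v => by rw [norm_mul, Circle.norm_coe, one_mul]]
  rwa [h3] at h2

lemma hausdorffMeasure_doublePlane_preimage {m : ℕ} {d : ℝ}
    (hfin : μH[d] (sphere (0 : Euc (m + 2)) 1) ≠ ⊤) {A : Set (Euc (m + 2))}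
    (hA : MeasurableSet A) :
    μH[d] (doublePlane ⁻¹' A ∩ sphere 0 1) = μH[d] (A ∩ sphere 0 1) := by
  let : MeasurableSpace Circle := borel Circle
  have : BorelSpace Circle := ⟨rfl⟩
  have : SecondCountableTopology Circle := inferInstance
  let κ : Measure Circle := Measure.haarMeasure ⊤
  have : IsProbabilityMeasure κ := ⟨Measure.haarMeasure_self⟩
  have hκ : MeasurePreserving (fun z : Circle => z ^ 2) κ κ := by
    refine MonoidHom.measurePreserving (f := (powMonoidHom 2 : Circle →* Circle))
      (continuous_pow 2) ?_ rfl
    intro z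
    refine ⟨Circle.exp (Complex.arg z / 2), ?_⟩
    rw [powMonoidHom_apply, pow_two, ← Circle.exp_add, add_halves, Circle.exp_arg]
  have : IsFiniteMeasure ((μH[d] : Measure (Euc (m + 2))).restrict (sphere 0 1)) :=
    ⟨by simpa using hfin.lt_top⟩
  have hD : Measurable (doublePlane (m := m)) := measurable_mapPlane (by fun_prop)
  have := measure_preimage_of_equivariant_sq κ hκ
    ((μH[d] : Measure (Euc (m + 2))).restrict (sphere 0 1)) (R := rotPlane) (D := doublePlane)
    (continuous_uncurry_rotPlane m).measurable rotPlane_mul (measurePreserving_rotPlane d) hD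
    ?_ ?_ hA
  · rwa [Measure.restrict_apply hA, Measure.restrict_apply (hD hA)] at this
  · intro z x
    unfold doublePlane rotPlane
    rw [mapPlane_mapPlane, mapPlane_mapPlane]
    refine mapPlane_congr ?_
    simp only [Function.comp_apply, Circle.coe_pow, norm_mul, Circle.norm_coe, one_mul]
    ring
  · intro x
    unfold doublePlane rotPlane
    rcases eq_or_ne (planePart x) 0 with h | h
    · exact ⟨1, mapPlane_congr (by simp [h])⟩
    · have h' : ‖planePart x‖ ≠ 0 := norm_ne_zero_iff.2 h
      refine ⟨Circle.exp (Complex.arg (planePart x)), mapPlane_congr ?_⟩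
      have h2 := Complex.norm_mul_exp_arg_mul_I (planePart x)
      have h3 : (‖planePart x‖ : ℂ) ≠ 0 := by exact_mod_cast h'
      rw [Circle.coe_exp, div_eq_iff h3]
      linear_combination (-planePart x) * h2

/-- The planar convex body whose support function at `(cos α, sin α)`, `|α| ≤ π / 2`, is
`cos (α / 2)`. -/
def halfAngleBody : Set (ℝ × ℝ) :=
  {p | ∀ c s : ℝ, c ^ 2 + s ^ 2 = 1 → p.1 * c + p.2 * s ≤ √((1 + |c|) / 2)}

lemma convex_halfAngleBody : Convex ℝ halfAngleBody := by
  intro p hp q hq a b ha hb hab c s hcs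
  have h1 := mul_le_mul_of_nonneg_left (hp c s hcs) ha
  have h2 := mul_le_mul_of_nonneg_left (hq c s hcs) hb
  have h3 : (a + b) * √((1 + |c|) / 2) = √((1 + |c|) / 2) := by rw [hab, one_mul]
  simp only [Prod.fst_add, Prod.snd_add, Prod.smul_fst, Prod.smul_snd, smul_eq_mul]
  linarith

lemma isCompact_halfAngleBody : IsCompact halfAngleBody := by
  refine (isCompact_Icc (a := ((-1, -1) : ℝ × ℝ)) (b := (1, 1))).of_isClosed_subset ?_ ?_
  · simp only [halfAngleBody, ofPred_forall]
    refine isClosed_iInter fun c => isClosed_iInter fun s => isClosed_iInter fun _ => ?_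
    exact isClosed_le (by fun_prop) continuous_const
  · intro p hp
    have h : ∀ c : ℝ, |c| ≤ 1 → √((1 + |c|) / 2) ≤ 1 := fun c hc =>
      Real.sqrt_le_iff.2 ⟨zero_le_one, by linarith⟩
    have h1 := (hp 1 0 (by norm_num)).trans (h _ (by norm_num))
    have h2 := (hp (-1) 0 (by norm_num)).trans (h _ (by norm_num))
    have h3 := (hp 0 1 (by norm_num)).trans (h _ (by norm_num))
    have h4 := (hp 0 (-1) (by norm_num)).trans (h _ (by norm_num))
    exact ⟨⟨by linarith, by linarith⟩, ⟨by linarith, by linarith⟩⟩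

lemma abs_le_of_mem_halfAngleBody {p : ℝ × ℝ} (hp : p ∈ halfAngleBody) {c s : ℝ}
    (hcs : c ^ 2 + s ^ 2 = 1) : |p.1 * c + p.2 * s| ≤ √((1 + |c|) / 2) := by
  have h := hp (-c) (-s) (by linarith)
  rw [abs_neg] at h
  exact abs_le.2 ⟨by linarith, hp c s hcs⟩

lemma smul_mem_halfAngleBody {p : ℝ × ℝ} (hp : p ∈ halfAngleBody) {r : ℝ} (hr : |r| ≤ 1) :
    r • p ∈ halfAngleBody := by
  intro c s hcs
  have h := abs_le_of_mem_halfAngleBody hp hcs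
  calc (r • p).1 * c + (r • p).2 * s = r * (p.1 * c + p.2 * s) := by
        simp only [Prod.smul_fst, Prod.smul_snd, smul_eq_mul]
        ring
    _ ≤ |r| * |p.1 * c + p.2 * s| := (le_abs_self _).trans (abs_mul _ _).le
    _ ≤ 1 * √((1 + |c|) / 2) := by gcongr
    _ = _ := one_mul _

lemma neg_mem_halfAngleBody {p : ℝ × ℝ} (hp : p ∈ halfAngleBody) : -p ∈ halfAngleBody := by
  simpa using smul_mem_halfAngleBody hp (r := -1) (by simp)

lemma exists_half_angle {c s : ℝ} (hcs : c ^ 2 + s ^ 2 = 1) (hc : 0 ≤ c) :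
    ∃ C S : ℝ, 0 < C ∧ |S| ≤ C ∧ C ^ 2 + S ^ 2 = 1 ∧ c = C ^ 2 - S ^ 2 ∧ s = 2 * C * S ∧
      √((1 + c) / 2) = C := by
  have hC : 0 < √((1 + c) / 2) := Real.sqrt_pos.2 (by linarith)
  have hC2 : √((1 + c) / 2) ^ 2 = (1 + c) / 2 := Real.sq_sqrt (by linarith)
  set C := √((1 + c) / 2)
  have hS : (s / (2 * C)) ^ 2 = (1 - c) / 2 := by
    rw [div_pow, mul_pow, hC2, div_eq_iff (by positivity)]
    nlinarith
  refine ⟨C, s / (2 * C), hC, ?_, by linarith, by linarith, by field_simp, rfl⟩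
  exact abs_le_of_sq_le_sq (by linarith) hC.le

lemma le_add_mul_half_angle {C S C' S' : ℝ} (hC : 0 < C) (hC' : 0 < C')
    (hSC' : |S'| ≤ C') (h1 : C ^ 2 + S ^ 2 = 1) (h1' : C' ^ 2 + S' ^ 2 = 1) :
    C ≤ C' + C * (C * C' + S * S') := by
  have h7 : C * |S| ≤ 1 / 2 := by
    have h := sq_nonneg (C - |S|)
    rw [sub_sq, sq_abs] at h
    linarith
  have h8 : 1 ≤ √2 * C' := by
    rw [← Real.sqrt_one, ← Real.sqrt_sq hC'.le, ← Real.sqrt_mul zero_le_two]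
    refine Real.sqrt_le_sqrt ?_
    have := sq_le_sq' (by linarith [abs_nonneg S']) hSC'
    rw [sq_abs] at this
    linarith
  have h9 : √2 ^ 2 = 2 := Real.sq_sqrt zero_le_two
  have h10 : √2 * C ≤ C ^ 2 + 1 / 2 := by
    have h := sq_nonneg (√2 * C - 1)
    rw [sub_sq, mul_pow, h9] at h
    linarith
  have h13 : -(|S| * C') ≤ S * S' := by
    refine (neg_le_neg ?_).trans (neg_abs_le (S * S'))
    rw [abs_mul]
    gcongr
  calc C = C * 1 := (mul_one C).symm
    _ ≤ C * (√2 * C') := by gcongr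
    _ = C' * (√2 * C) := by ring
    _ ≤ C' * (C ^ 2 + 1 / 2) := by gcongr
    _ ≤ C' * (C ^ 2 + (1 - C * |S|)) := by
      gcongr
      linarith
    _ = C' + C * (C * C' + -(|S| * C')) := by ring
    _ ≤ C' + C * (C * C' + S * S') := by gcongr

lemma abs_boundary_point_le {C S k l C' : ℝ} (hC : 0 < C) (hC' : 0 < C') (hk : 0 ≤ k)
    (hkl : k ^ 2 + l ^ 2 = 1) (hCkl : C' = C * k + S * l) (h : C ≤ C' + C * k) :
    |C * (k ^ 2 - l ^ 2) + S * k * l| ≤ C' := by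
  have hk1 : k ≤ 1 := by nlinarith [sq_nonneg l]
  have h1 : C' + (C * (k ^ 2 - l ^ 2) + S * k * l) = (1 + k) * (C' + C * k - C) := by
    linear_combination (-C) * hkl + (-k) * hCkl
  have h2 : C' - (C * (k ^ 2 - l ^ 2) + S * k * l) = (1 - k) * (C + C' + C * k) := by
    linear_combination C * hkl + k * hCkl
  have h3 : 0 ≤ (1 + k) * (C' + C * k - C) := mul_nonneg (by linarith) (by linarith)
  have h4 : 0 ≤ (1 - k) * (C + C' + C * k) := mul_nonneg (by linarith) (by positivity)
  exact abs_le.2 ⟨by linarith, by linarith⟩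

lemma exists_mem_halfAngleBody_of_nonneg {c s : ℝ} (hcs : c ^ 2 + s ^ 2 = 1) (hc : 0 ≤ c) :
    ∃ p ∈ halfAngleBody, p.1 * c + p.2 * s = √((1 + |c|) / 2) := by
  obtain ⟨C, S, hC, hSC, h1, hcC, hsC, h4⟩ := exists_half_angle hcs hc
  rw [abs_of_nonneg hc, h4]
  refine ⟨(C * c + S * s / 2, C * s - S * c / 2), ?_, by linear_combination C * hcs⟩
  have key : ∀ c' s' : ℝ, c' ^ 2 + s' ^ 2 = 1 → 0 ≤ c' →
      |(C * c + S * s / 2) * c' + (C * s - S * c / 2) * s'| ≤ √((1 + c') / 2) := by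
    intro c' s' hcs' hc'
    obtain ⟨C', S', hC', hSC', h1', hcC', hsC', h4'⟩ := exists_half_angle hcs' hc'
    rw [h4']
    have hSS : |S * S'| ≤ C * C' := by
      rw [abs_mul]
      gcongr
    have hval : (C * c + S * s / 2) * c' + (C * s - S * c / 2) * s' =
        C * ((C * C' + S * S') ^ 2 - (S * C' - C * S') ^ 2) +
          S * (C * C' + S * S') * (S * C' - C * S') := by
      rw [hcC, hsC, hcC', hsC']
      ring
    rw [hval]
    refine abs_boundary_point_le hC hC' (by linarith [neg_abs_le (S * S')]) ?_ ?_
      (le_add_mul_half_angle hC hC' hSC' h1 h1')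
    · linear_combination (C' ^ 2 + S' ^ 2) * h1 + h1'
    · linear_combination -C' * h1
  intro c' s' hcs'
  rcases le_total 0 c' with h | h
  · rw [abs_of_nonneg h]
    exact (le_abs_self _).trans (key c' s' hcs' h)
  · rw [abs_of_nonpos h]
    have := (neg_le_abs _).trans (key (-c') (-s') (by linarith) (by linarith))
    simp only [mul_neg] at this
    linarith

lemma exists_mem_halfAngleBody {c s : ℝ} (hcs : c ^ 2 + s ^ 2 = 1) :
    ∃ p ∈ halfAngleBody, p.1 * c + p.2 * s = √((1 + |c|) / 2) := by
  rcases le_total 0 c with h | h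
  · exact exists_mem_halfAngleBody_of_nonneg hcs h
  · obtain ⟨p, hp, hps⟩ := exists_mem_halfAngleBody_of_nonneg (c := -c) (s := -s) (by linarith)
      (by linarith)
    refine ⟨-p, neg_mem_halfAngleBody hp, ?_⟩
    rw [abs_neg] at hps
    rw [← hps]
    simp

/-- The rotation of the plane taking the unit vector `(c, s)` to `(1, 0)`. -/
def planeRotation {c s : ℝ} (hcs : c ^ 2 + s ^ 2 = 1) : (ℝ × ℝ) ≃ₗ[ℝ] ℝ × ℝ where
  toFun p := (c * p.1 + s * p.2, -s * p.1 + c * p.2)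
  map_add' p q := by ext <;> simp <;> ring
  map_smul' r p := by ext <;> simp <;> ring
  invFun p := (c * p.1 - s * p.2, s * p.1 + c * p.2)
  left_inv p := by
    ext
    · simp only
      linear_combination p.1 * hcs
    · simp only
      linear_combination p.2 * hcs
  right_inv p := by
    ext
    · simp only
      linear_combination p.1 * hcs
    · simp only
      linear_combination p.2 * hcs

lemma measurePreserving_planeRotation {c s : ℝ} (hcs : c ^ 2 + s ^ 2 = 1) :
    MeasurePreserving (planeRotation hcs) := by
  set f : (ℝ × ℝ) →ₗ[ℝ] ℝ × ℝ := (planeRotation hcs).toLinearMap with hf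
  have h : f = Matrix.toLin (Module.Basis.finTwoProd ℝ) (Module.Basis.finTwoProd ℝ)
      !![c, s; -s, c] := by
    refine LinearMap.ext fun p => ?_
    rw [Matrix.toLin_finTwoProd_apply]
    rfl
  have hdet : LinearMap.det f = 1 := by
    rw [h, LinearMap.det_toLin, Matrix.det_fin_two_of]
    linarith
  refine ⟨f.continuous_of_finiteDimensional.measurable, ?_⟩
  have := Measure.map_linearMap_addHaar_eq_smul_addHaar (volume : Measure (ℝ × ℝ)) (f := f)
    (by rw [hdet]; exact one_ne_zero)
  rw [hdet] at this
  change Measure.map f volume = volume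
  simpa using this

lemma hasRate_halfAngleBody_of_unit {c s : ℝ} (hcs : c ^ 2 + s ^ 2 = 1) :
    HasRate halfAngleBody (c, s) (ENNReal.ofReal (2 * √((1 + |s|) / 2))) := by
  set T := planeRotation hcs with hT
  have hTc : Continuous T := T.toLinearMap.continuous_of_finiteDimensional
  have hK' : IsCompact (T '' halfAngleBody) := isCompact_halfAngleBody.image hTc
  have hKc' : Convex ℝ (T '' halfAngleBody) := convex_halfAngleBody.linear_image T.toLinearMap
  have hTθ : T (c, s) = (1, 0) := by
    simp only [hT, planeRotation, LinearEquiv.coe_mk, LinearMap.coe_mk, AddHom.coe_mk]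
    ext
    · simp only
      linarith
    · simp only
      ring
  have hsc : (-s) ^ 2 + c ^ 2 = 1 := by linarith
  have hproj : Prod.snd '' (T '' halfAngleBody) =
      Icc (-√((1 + |s|) / 2)) (√((1 + |s|) / 2)) := by
    have hM : 0 < √((1 + |s|) / 2) := Real.sqrt_pos.2 (by positivity)
    have hsnd : ∀ p, (T p).2 = p.1 * (-s) + p.2 * c := fun p => by
      change -s * p.1 + c * p.2 = _
      ring
    rw [image_image]
    ext x
    simp only [hsnd]
    constructor
    · rintro ⟨p, hp, rfl⟩
      have := abs_le_of_mem_halfAngleBody hp hsc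
      rwa [abs_neg, abs_le] at this
    · intro hx
      obtain ⟨p, hp, hps⟩ := exists_mem_halfAngleBody hsc
      rw [abs_neg] at hps
      refine ⟨(x / √((1 + |s|) / 2)) • p, smul_mem_halfAngleBody hp ?_, ?_⟩
      · rw [abs_div, abs_of_pos hM, div_le_one hM]
        exact abs_le.2 hx
      · change ((x / √((1 + |s|) / 2)) • p).1 * -s + ((x / √((1 + |s|) / 2)) • p).2 * c = x
        rw [Prod.smul_fst, Prod.smul_snd, smul_eq_mul, smul_eq_mul, mul_assoc, mul_assoc,
          ← mul_add, hps, div_mul_cancel₀ _ hM.ne']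
  have h := hasRate_fst hK' hKc'
  rw [← hTθ] at h
  have := h.preimage T (measurePreserving_planeRotation hcs)
    fun v s => (hK'.sweep v s).measurableSet
  rw [preimage_image_eq _ T.injective, hproj, Real.volume_Icc,
    sub_neg_eq_add, ← two_mul] at this
  exact this

lemma hasRate_halfAngleBody (w : ℂ) : HasRate halfAngleBody (w.re, w.im)
    (ENNReal.ofReal (√2 * √(‖w‖ ^ 2 + ‖w‖ * |w.im|))) := by
  rcases eq_or_ne w 0 with rfl | hw
  · intro s hs
    have : ((0 : ℝ), (0 : ℝ)) = 0 := rfl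
    simp [this, sweep_zero_vec _ hs]
  · have hr : 0 < ‖w‖ := norm_pos_iff.2 hw
    have hn : ‖w‖ ^ 2 = w.re ^ 2 + w.im ^ 2 := by
      rw [Complex.sq_norm, Complex.normSq_apply]
      ring
    have hu : (w.re / ‖w‖) ^ 2 + (w.im / ‖w‖) ^ 2 = 1 := by
      rw [div_pow, div_pow, ← add_div, ← hn, div_self (by positivity)]
    have h := (hasRate_halfAngleBody_of_unit hu).smul_vec hr.le
    have hvec : ‖w‖ • (w.re / ‖w‖, w.im / ‖w‖) = (w.re, w.im) := by
      rw [Prod.smul_mk, smul_eq_mul, smul_eq_mul, mul_div_cancel₀ _ hr.ne',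
        mul_div_cancel₀ _ hr.ne']
    have hval : ‖w‖ * (2 * √((1 + |w.im / ‖w‖|) / 2)) = √2 * √(‖w‖ ^ 2 + ‖w‖ * |w.im|) := by
      rw [← Real.sqrt_mul zero_le_two, eq_comm, Real.sqrt_eq_iff_mul_self_eq (by positivity)
        (by positivity), ← sq, mul_pow, mul_pow, Real.sq_sqrt (by positivity), abs_div, abs_norm]
      field_simp
    rw [hvec, ← ENNReal.ofReal_mul hr.le, hval] at h
    exact h

lemma ellipse_subset_halfAngleBody : {p : ℝ × ℝ | p.1 ^ 2 + 2 * p.2 ^ 2 ≤ 1} ⊆ halfAngleBody := by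
  intro p hp c s hcs
  refine Real.le_sqrt_of_sq_le ?_
  have hp' : p.1 ^ 2 + 2 * p.2 ^ 2 ≤ 1 := hp
  have h1 : (p.1 * c + p.2 * s) ^ 2 ≤ (p.1 ^ 2 + 2 * p.2 ^ 2) * (c ^ 2 + s ^ 2 / 2) := by
    nlinarith [sq_nonneg (p.1 * s - 2 * p.2 * c)]
  have h2 : (p.1 ^ 2 + 2 * p.2 ^ 2) * (c ^ 2 + s ^ 2 / 2) ≤ 1 * (c ^ 2 + s ^ 2 / 2) := by
    gcongr
  have h3 : |c| ≤ 1 := abs_le_one_iff_mul_self_le_one.2 (by nlinarith [sq_nonneg s])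
  nlinarith [sq_abs c, abs_nonneg c]

lemma interior_halfAngleBody_nonempty : (interior halfAngleBody).Nonempty := by
  refine ⟨(0, 0), mem_interior.2 ⟨{p | p.1 ^ 2 + 2 * p.2 ^ 2 < 1}, ?_, ?_, by simp⟩⟩
  · exact fun p hp => ellipse_subset_halfAngleBody
      (show p.1 ^ 2 + 2 * p.2 ^ 2 ≤ 1 from (show p.1 ^ 2 + 2 * p.2 ^ 2 < 1 from hp).le)
  · exact isOpen_lt (by fun_prop) continuous_const

lemma two_lt_volume_halfAngleBody : 2 < volume halfAngleBody := by
  set f : (ℝ × ℝ) →ₗ[ℝ] ℝ × ℝ := Matrix.toLin (Module.Basis.finTwoProd ℝ)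
    (Module.Basis.finTwoProd ℝ) !![1, 0; 0, √2] with hf
  have hdet : LinearMap.det f = √2 := by
    rw [hf, LinearMap.det_toLin, Matrix.det_fin_two_of]
    ring
  have hdisc : volume {p : ℝ × ℝ | p.1 ^ 2 + p.2 ^ 2 ≤ 1} = ENNReal.ofReal Real.pi := by
    have hm : MeasurableSet {p : ℝ × ℝ | p.1 ^ 2 + p.2 ^ 2 ≤ 1} :=
      (isClosed_le (by fun_prop) continuous_const).measurableSet
    rw [← Complex.volume_preserving_equiv_real_prod.measure_preimage hm.nullMeasurableSet]
    have : Complex.measurableEquivRealProd ⁻¹' {p : ℝ × ℝ | p.1 ^ 2 + p.2 ^ 2 ≤ 1} =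
        closedBall 0 1 := by
      ext z
      rw [mem_closedBall_zero_iff, ← sq_le_one_iff₀ (norm_nonneg z), Complex.sq_norm,
        Complex.normSq_apply, ← sq, ← sq]
      rfl
    rw [this, Complex.volume_closedBall]
    simp [← NNReal.coe_real_pi, ENNReal.ofReal_coe_nnreal]
  have hpre : f ⁻¹' {p : ℝ × ℝ | p.1 ^ 2 + p.2 ^ 2 ≤ 1} =
      {p : ℝ × ℝ | p.1 ^ 2 + 2 * p.2 ^ 2 ≤ 1} := by
    ext p
    simp [hf, Matrix.toLin_finTwoProd_apply, mul_pow]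
  calc (2 : ℝ≥0∞) = ENNReal.ofReal 2 := by simp
    _ < ENNReal.ofReal (|(√2)⁻¹| * Real.pi) := by
      have h2 : √2 < 1.5 := by
        rw [Real.sqrt_lt' (by norm_num)]
        norm_num
      rw [ENNReal.ofReal_lt_ofReal_iff (by positivity), abs_of_pos (by positivity),
        inv_mul_eq_div, lt_div_iff₀ (by positivity)]
      linarith [Real.pi_gt_three]
    _ = volume {p : ℝ × ℝ | p.1 ^ 2 + 2 * p.2 ^ 2 ≤ 1} := by
      rw [← hpre, Measure.addHaar_preimage_linearMap _ (by rw [hdet]; positivity), hdet, hdisc,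
        ENNReal.ofReal_mul (by positivity)]
    _ ≤ volume halfAngleBody := measure_mono ellipse_subset_halfAngleBody

lemma hasRate_Icc {c : ℝ} (hc : 0 ≤ c) (x : ℝ) :
    HasRate (Icc (-c) c) x (ENNReal.ofReal |x|) := by
  have h1 : HasRate (Icc (-c) c) (1 : ℝ) 1 := fun s hs => by
    rw [mul_one]
    exact volume_Icc_sweep isCompact_Icc (convex_Icc _ _) ⟨0, by simpa, hc⟩ hs
  have h := h1.smul_vec (abs_nonneg x)
  rw [smul_eq_mul, mul_one, mul_one] at h
  rcases le_total 0 x with hx | hx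
  · rwa [abs_of_nonneg hx] at h ⊢
  · rw [abs_of_nonpos hx] at h ⊢
    have h2 := HasRate.preimage (LinearEquiv.neg ℝ) (v := x)
      (Measure.measurePreserving_neg (volume : Measure ℝ))
      (fun v s => (isCompact_Icc.sweep v s).measurableSet) h
    have h3 : LinearEquiv.neg ℝ ⁻¹' Icc (-c) c = Icc (-c) c := by
      ext y
      simp [and_comm, neg_le]
    rwa [h3] at h2

lemma hasRate_square {q : ℝ} (hq : 0 < q) (w : ℂ) :
    HasRate (Icc (-(q / 2)) (q / 2) ×ˢ Icc (-(q / 2)) (q / 2)) (w.re, w.im)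
      (ENNReal.ofReal (q * (|w.re| + |w.im|))) := by
  have h := HasRate.prod isCompact_Icc isCompact_Icc (convex_Icc _ _)
    (hasRate_Icc (half_pos hq).le w.re) (hasRate_Icc (half_pos hq).le w.im)
  rwa [Real.volume_Icc, sub_neg_eq_add, add_halves, ← mul_add,
    ← ENNReal.ofReal_add (abs_nonneg _) (abs_nonneg _), ← ENNReal.ofReal_mul hq.le] at h

lemma exists_measurable_hasRate {m : ℕ} {Q : Set (Euc m)} (hQ : IsCompact Q) (hQc : Convex ℝ Q) :
    ∃ g : Euc m → ℝ≥0∞, Measurable g ∧ ∀ v, HasRate Q v (g v) := by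
  refine ⟨fun v => volume (sweep Q v 1) - volume Q, ?_, fun v => ?_⟩
  · refine Measurable.sub_const ?_ _
    have hclosed : IsClosed {p : Euc m × Euc m | p.2 ∈ sweep Q p.1 1} := by
      have h1 : IsClosed {p : Icc (0 : ℝ) 1 × (Euc m × Euc m) |
          p.2.2 - (p.1 : ℝ) • p.2.1 ∈ Q} :=
        hQ.isClosed.preimage (by fun_prop)
      convert isClosedMap_snd_of_compactSpace _ h1 using 1
      ext p
      simp [sweep]
    exact measurable_measure_prodMk_left hclosed.measurableSet
  · obtain ⟨g, hg⟩ := exists_hasRate hQ hQc v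
    have h1 := hg 1 zero_le_one
    rw [ENNReal.ofReal_one, one_mul] at h1
    simpa only [h1, ENNReal.add_sub_cancel_left hQ.measure_ne_top] using hg

lemma isConvexBody_preimage_splitEquiv {m : ℕ} {P : Set (ℝ × ℝ)} {Q : Set (Euc m)}
    (hP : Convex ℝ P) (hPc : IsCompact P) (hPi : (interior P).Nonempty) (hQ : Convex ℝ Q)
    (hQc : IsCompact Q) (hQi : (interior Q).Nonempty) :
    IsConvexBody (splitEquiv m ⁻¹' (P ×ˢ Q)) := by
  refine ⟨(hP.prod hQ).linear_preimage (splitEquiv m).toLinearMap, ?_, ?_⟩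
  · rw [← LinearEquiv.image_symm_eq_preimage]
    exact (hPc.prod hQc).image (continuous_splitEquiv_symm m)
  · refine Set.Nonempty.mono
      (preimage_interior_subset_interior_preimage (continuous_splitEquiv m)) ?_
    rw [interior_prod_eq]
    exact (hPi.prod hQi).preimage (splitEquiv m).surjective

lemma preimage_splitEquiv_eq_neg {m : ℕ} {P : Set (ℝ × ℝ)} {Q : Set (Euc m)}
    (hP : ∀ p ∈ P, -p ∈ P) (hQ : ∀ y ∈ Q, -y ∈ Q) :
    splitEquiv m ⁻¹' (P ×ˢ Q) = -(splitEquiv m ⁻¹' (P ×ˢ Q)) := by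
  have h : ∀ x ∈ splitEquiv m ⁻¹' (P ×ˢ Q), -x ∈ splitEquiv m ⁻¹' (P ×ˢ Q) := fun x hx => by
    rw [mem_preimage, map_neg]
    exact ⟨hP _ hx.1, hQ _ hx.2⟩
  ext x
  exact ⟨fun hx => h x hx, fun hx => neg_neg x ▸ h _ hx⟩

lemma volume_preimage_splitEquiv {m : ℕ} {P : Set (ℝ × ℝ)} {Q : Set (Euc m)}
    (hP : IsCompact P) (hQ : IsCompact Q) :
    volume (splitEquiv m ⁻¹' (P ×ˢ Q)) = volume P * volume Q := by
  rw [(measurePreserving_splitEquiv m).measure_preimage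
    (hP.prod hQ).measurableSet.nullMeasurableSet]
  exact Measure.prod_prod P Q

lemma hasRate_preimage_splitEquiv {m : ℕ} {P : Set (ℝ × ℝ)} {Q : Set (Euc m)}
    (hP : IsCompact P) (hQ : IsCompact Q) (hQc : Convex ℝ Q) {θ : Euc (m + 2)} {g g' : ℝ≥0∞}
    (hg : HasRate P ((planePart θ).re, (planePart θ).im) g)
    (hg' : HasRate Q (splitEquiv m θ).2 g') :
    HasRate (splitEquiv m ⁻¹' (P ×ˢ Q)) θ (volume Q * g + volume P * g') :=
  HasRate.preimage (splitEquiv m) (measurePreserving_splitEquiv m)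
    (fun v s => ((hP.prod hQ).sweep v s).measurableSet) (HasRate.prod hP hQ hQc hg hg')

lemma sqrt_norm_sq_add_sq_div_norm (w : ℂ) :
    √(‖w ^ 2 / ‖w‖‖ ^ 2 + ‖w ^ 2 / ‖w‖‖ * |(w ^ 2 / ‖w‖).im|) = |w.re| + |w.im| := by
  rcases eq_or_ne w 0 with rfl | hw
  · simp
  have hr : 0 < ‖w‖ := norm_pos_iff.2 hw
  have him : ‖w‖ * |(w ^ 2 / ‖w‖).im| = 2 * (|w.re| * |w.im|) := by
    rw [Complex.div_ofReal_im, abs_div, abs_norm, mul_div_cancel₀ _ hr.ne', sq, Complex.mul_im,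
      mul_comm w.im, ← two_mul, abs_mul, abs_mul, abs_two]
  rw [norm_sq_div_norm, him, Complex.sq_norm, Complex.normSq_apply, ← abs_mul_abs_self w.re,
    ← abs_mul_abs_self w.im, Real.sqrt_eq_iff_mul_self_eq (by positivity) (by positivity)]
  ring

lemma piDist_eq_of_doublePlane {m : ℕ} {K L : Set (Euc (m + 2))} {f : Euc (m + 2) → ℝ≥0∞}
    (hf : Measurable f) (hK : ∀ θ, ‖θ‖ = 1 → projVol (m + 2) K θ = f θ)
    (hL : ∀ θ, ‖θ‖ = 1 → projVol (m + 2) L θ = f (doublePlane θ)) (t : ℝ) :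
    PiDist (m + 2) K t = PiDist (m + 2) L t := by
  unfold PiDist sphHaar
  by_cases hfin : μH[((m + 2 : ℕ) : ℝ) - 1] (sphere (0 : Euc (m + 2)) 1) = ⊤
  · rw [hfin, ENNReal.div_top, ENNReal.div_top]
  have h1 : {θ | ENNReal.ofReal t ≤ projVol (m + 2) K θ} ∩ sphere 0 1 =
      {θ | ENNReal.ofReal t ≤ f θ} ∩ sphere 0 1 := by
    ext θ
    refine and_congr_left fun hθ => ?_
    rw [mem_ofPred_eq, hK θ (mem_sphere_zero_iff_norm.1 hθ), mem_ofPred_eq]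
  have h2 : {θ | ENNReal.ofReal t ≤ projVol (m + 2) L θ} ∩ sphere 0 1 =
      doublePlane ⁻¹' {θ | ENNReal.ofReal t ≤ f θ} ∩ sphere 0 1 := by
    ext θ
    refine and_congr_left fun hθ => ?_
    rw [mem_ofPred_eq, hL θ (mem_sphere_zero_iff_norm.1 hθ), mem_preimage, mem_ofPred_eq]
  rw [h1, h2, hausdorffMeasure_doublePlane_preimage hfin (measurableSet_le measurable_const hf)]

lemma exists_scaling (m : ℕ) {A : ℝ} (hA : 2 < A) : ∃ b q : ℝ, 0 < b ∧ b < 1 ∧ 0 < q ∧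
    b ^ m * q = √2 ∧ q * q * (b ^ m * b⁻¹) = A ∧ q * q * b ^ m = A * b := by
  have hA0 : 0 < A := by linarith
  set b := (2 / A) ^ (((m + 1 : ℕ) : ℝ)⁻¹) with hb_def
  have hb : 0 < b := Real.rpow_pos_of_pos (by positivity) _
  have hbm : b ^ (m + 1) = 2 / A := Real.rpow_inv_natCast_pow (by positivity) (by simp)
  have h2 : √2 ^ 2 = 2 := Real.sq_sqrt zero_le_two
  have hAb : A * b ^ (m + 1) = 2 := by
    rw [hbm]
    field_simp
  have hsq : A * b / √2 * (A * b / √2) = A ^ 2 * b ^ 2 / 2 := by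
    rw [← sq, div_pow, h2, mul_pow]
  have hlast : A * b / √2 * (A * b / √2) * b ^ m = A * b := by
    rw [hsq]
    linear_combination A * b / 2 * hAb
  refine ⟨b, A * b / √2, hb, ?_, by positivity, ?_, ?_, hlast⟩
  · exact Real.rpow_lt_one (by positivity) (by rwa [div_lt_one hA0]) (by positivity)
  · rw [mul_div_assoc', div_eq_iff (by positivity), ← sq, h2]
    linear_combination hAb
  · rw [← mul_assoc, hlast, mul_inv_cancel_right₀ hb.ne']

/-- For every `n ≥ 2` there are origin-symmetric convex bodies in `ℝⁿ` with
the same distribution function of volumes of projections but different volumes. -/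
theorem stmt_13 (n : ℕ) (hn : 2 ≤ n) : ∃ K L : Set (Euc n),
    IsConvexBody K ∧ IsConvexBody L ∧ K = -K ∧ L = -L ∧
    (∀ t : ℝ, 0 ≤ t → PiDist n K t = PiDist n L t) ∧
    volume K ≠ volume L := by
  obtain ⟨m, rfl⟩ := Nat.exists_eq_add_of_le' hn
  have hA_top : volume halfAngleBody ≠ ⊤ := isCompact_halfAngleBody.measure_ne_top
  have hA : 2 < (volume halfAngleBody).toReal := by
    simpa using (ENNReal.toReal_lt_toReal ENNReal.ofNat_ne_top hA_top).2
      two_lt_volume_halfAngleBody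
  have hA_vol := ENNReal.ofReal_toReal hA_top
  generalize (volume halfAngleBody).toReal = A at hA hA_vol
  obtain ⟨b, q, hb, hb1, hq, hbq, hqA, hvol⟩ := exists_scaling m hA
  have hQ : IsCompact (closedBall (0 : Euc m) 1) := isCompact_closedBall 0 1
  have hQc : Convex ℝ (closedBall (0 : Euc m) 1) := convex_closedBall 0 1
  have hbQ : (b • ·) '' closedBall (0 : Euc m) 1 = closedBall 0 b := by
    rw [image_smul, smul_unitClosedBall_of_nonneg hb.le]
  have hQ' : IsCompact (closedBall (0 : Euc m) b) := isCompact_closedBall 0 b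
  have hQc' : Convex ℝ (closedBall (0 : Euc m) b) := convex_closedBall 0 b
  have hvolQ' : volume (closedBall (0 : Euc m) b) =
      ENNReal.ofReal (b ^ m) * volume (closedBall (0 : Euc m) 1) := by
    rw [Measure.addHaar_closedBall' _ _ hb.le, finrank_euclideanSpace_fin]
  have hI : IsCompact (Icc (-(q / 2)) (q / 2) ×ˢ Icc (-(q / 2)) (q / 2)) :=
    isCompact_Icc.prod isCompact_Icc
  have hIc : Convex ℝ (Icc (-(q / 2)) (q / 2) ×ˢ Icc (-(q / 2)) (q / 2)) :=
    (convex_Icc _ _).prod (convex_Icc _ _)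
  have hIi : (interior (Icc (-(q / 2)) (q / 2) ×ˢ Icc (-(q / 2)) (q / 2))).Nonempty := by
    rw [interior_prod_eq, interior_Icc, prod_nonempty_iff, nonempty_Ioo]
    exact ⟨by linarith, by linarith⟩
  have hvolI : volume (Icc (-(q / 2)) (q / 2) ×ˢ Icc (-(q / 2)) (q / 2)) =
      ENNReal.ofReal (q * q) := by
    rw [Measure.volume_eq_prod, Measure.prod_prod, Real.volume_Icc, sub_neg_eq_add, add_halves,
      ENNReal.ofReal_mul hq.le]
  have hK := isConvexBody_preimage_splitEquiv convex_halfAngleBody isCompact_halfAngleBody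
    interior_halfAngleBody_nonempty hQc hQ (by simp [interior_closedBall])
  have hL := isConvexBody_preimage_splitEquiv hIc hI hIi hQc' hQ'
    (by simp [interior_closedBall _ hb.ne', hb])
  refine ⟨_, _, hK, hL,
    preimage_splitEquiv_eq_neg (fun p => neg_mem_halfAngleBody) (fun y hy => by simpa using hy),
    preimage_splitEquiv_eq_neg (fun p hp => ?_) (fun y hy => by simpa using hy), ?_, ?_⟩
  · obtain ⟨⟨h1, h2⟩, h3, h4⟩ := hp
    exact ⟨⟨neg_le_neg h2, neg_le.1 h1⟩, neg_le_neg h4, neg_le.1 h3⟩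
  · intro t _
    obtain ⟨C, hC⟩ := exists_hasRate_projVol (m + 1)
    obtain ⟨g, hg_meas, hg⟩ := exists_measurable_hasRate hQ hQc
    have hproj : ∀ {M : Set (Euc (m + 2))} {θ r}, IsConvexBody M → HasRate M θ r → ‖θ‖ = 1 →
        projVol (m + 2) M θ = C * r := fun hM hr hθ => by
      obtain ⟨r', hr', h⟩ := hC _ _ hM.2.1 hM.1 hθ
      rw [h, hr.unique hr' hM.2.1.measure_ne_top]
    refine piDist_eq_of_doublePlane (f := fun θ => C *
      (volume (closedBall (0 : Euc m) 1) *
        ENNReal.ofReal (√2 * √(‖planePart θ‖ ^ 2 + ‖planePart θ‖ * |(planePart θ).im|)) +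
      volume halfAngleBody * g (splitEquiv m θ).2)) ?_ (fun θ hθ => ?_) (fun θ hθ => ?_) t
    · have h1 := continuous_planePart m
      have h2 := (hg_meas.comp measurable_snd).comp (continuous_splitEquiv m).measurable
      have h3 : Continuous fun θ : Euc (m + 2) =>
          √2 * √(‖planePart θ‖ ^ 2 + ‖planePart θ‖ * |(planePart θ).im|) :=
        Continuous.comp (g := fun w : ℂ => √2 * √(‖w‖ ^ 2 + ‖w‖ * |w.im|)) (by fun_prop) h1
      exact ((h3.measurable.ennreal_ofReal.const_mul _).add (h2.const_mul _)).const_mul _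
    · exact hproj hK (hasRate_preimage_splitEquiv isCompact_halfAngleBody hQ hQc
        (hasRate_halfAngleBody _) (hg _)) hθ
    · have hg' := (hg (splitEquiv m θ).2).smul hb
      rw [hbQ, finrank_euclideanSpace_fin] at hg'
      rw [hproj hL (hasRate_preimage_splitEquiv hI hQ' hQc' (hasRate_square hq _) hg') hθ]
      congr 2
      · rw [doublePlane, planePart_mapPlane, sqrt_norm_sq_add_sq_div_norm, hvolQ', mul_right_comm,
          mul_comm _ (volume _), ← ENNReal.ofReal_mul (by positivity), ← mul_assoc, hbq]
      · rw [doublePlane, splitEquiv_mapPlane, hvolI, ← mul_assoc,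
          ← ENNReal.ofReal_mul (by positivity), hqA, hA_vol]
  · rw [volume_preimage_splitEquiv isCompact_halfAngleBody hQ, volume_preimage_splitEquiv hI hQ',
      hvolI, hvolQ', ← hA_vol, ← mul_assoc, ← ENNReal.ofReal_mul (by positivity), hvol]
    intro h
    have h0 : volume (closedBall (0 : Euc m) 1) ≠ 0 :=
      (measure_closedBall_pos _ _ zero_lt_one).ne'
    have h1 := (ENNReal.mul_left_inj h0 hQ.measure_ne_top).1 h
    rw [ENNReal.ofReal_eq_ofReal_iff (by linarith) (by nlinarith)] at h1
    nlinarith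
end
end
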